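/- arXiv:math/0509274 — 3 statements merged into one kernel-verified Lean document; each statement's English description precedes it below -/
import Mathlib

section
/- For every u0 ∈ L^1_loc(ℝ^d) there is at most one weak solution of the linear advection problem: if u and v are both weak solutions with the same initial datum u0, then u = v almost everywhere on ℝ^d × (0,∞). -/
open MeasureTheory Measure Set
open scoped ENNReal NNReal InnerProductSpace Topology

noncomputable section

/-- `d`-dimensional Euclidean space `ℝ^d`. -/
abbrev Euc (d : ℕ) : Type := EuclideanSpace ℝ (Fin d)

/-- `V(·,t)` is divergence-free in the sense of distributions for every `t ≥ 0`. -/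
def DivFree (d : ℕ) (V : Euc d → ℝ → Euc d) : Prop :=
  ∀ t : ℝ, 0 ≤ t → ∀ ψ : Euc d → ℝ, ContDiff ℝ (⊤ : ℕ∞) ψ → HasCompactSupport ψ →
    ∫ x : Euc d, fderiv ℝ ψ x (V x t) = 0

/-- `u` is a weak solution of `∂ₜ u + div (V u) = 0`, `u(·,0) = u0`. -/
def IsWeakSol (d : ℕ) (V : Euc d → ℝ → Euc d) (u0 : Euc d → ℝ)
    (u : Euc d → ℝ → ℝ) : Prop :=
  LocallyIntegrableOn (fun p : Euc d × ℝ => u p.1 p.2) {p : Euc d × ℝ | 0 ≤ p.2} ∧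
  ∀ φ : Euc d × ℝ → ℝ, ContDiff ℝ (⊤ : ℕ∞) φ → HasCompactSupport φ →
    (∫ t in Ioi (0 : ℝ), ∫ x : Euc d,
        u x t * (fderiv ℝ φ (x, t) (0, 1) + fderiv ℝ φ (x, t) (V x t, 0)))
      + ∫ x : Euc d, u0 x * φ (x, 0) = 0

/-- A bounded Lipschitz vector field has trajectories on any interval `[0, T]`. -/
theorem exists_forall_hasDerivWithinAt_of_lipschitzWith {E : Type*} [NormedAddCommGroup E]
    [NormedSpace ℝ E] [CompleteSpace E] {F : E → E} {K C : ℝ≥0} (hF : LipschitzWith K F)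
    (hC : ∀ x, ‖F x‖ ≤ C) {T : ℝ} (hT : 0 ≤ T) :
    ∃ Y : E → ℝ → E, ∀ p, Y p 0 = p ∧
      ∀ s ∈ Icc 0 T, HasDerivWithinAt (Y p) (F (Y p s)) (Icc 0 T) s := by
  have h (p : E) : ∃ y : ℝ → E, y 0 = p ∧
      ∀ s ∈ Icc 0 T, HasDerivWithinAt y (F (y s)) (Icc 0 T) s := by
    have hPL : IsPicardLindelof (fun _ => F) (⟨0, left_mem_Icc.2 hT⟩ : Icc 0 T) p
        (C * T.toNNReal) 0 C K := by
      refine .of_time_independent (fun x _ => hC x) hF.lipschitzOnWith ?_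
      simp [hT, Real.coe_toNNReal T hT]
    exact hPL.exists_eq_forall_mem_Icc_hasDerivWithinAt₀
  choose Y hY using h
  exact ⟨Y, hY⟩

/-- Along a bounded Lipschitz field `F` transverse to the level sets of `ℓ`, the transport
equation `∂_F φ = ψ` has a Lipschitz solution on `{0 < ℓ}` which vanishes far away. -/
theorem exists_lipschitzWith_fderiv_apply_eq {E : Type*} [NormedAddCommGroup E]
    [NormedSpace ℝ E] [CompleteSpace E] {F : E → E} {K C : ℝ≥0} (hF : LipschitzWith K F)
    (hC : ∀ x, ‖F x‖ ≤ C) (ℓ : E →L[ℝ] ℝ) (hℓ : ∀ x, ℓ (F x) = 1)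
    {ψ : E → ℝ} {M : ℝ≥0} (hψ : LipschitzWith M ψ) {R : ℝ} (hψR : ∀ p, R < ‖p‖ → ψ p = 0)
    {T : ℝ} (hT : 0 ≤ T) (hψT : ∀ p, T ≤ ℓ p → ψ p = 0) :
    ∃ (φ : E → ℝ) (L : ℝ≥0), LipschitzWith L φ ∧ (∀ p, R + C * T < ‖p‖ → φ p = 0) ∧
      ∀ p, 0 < ℓ p → DifferentiableAt ℝ φ p → fderiv ℝ φ p (F p) = ψ p := by
  obtain ⟨Y, hY⟩ := exists_forall_hasDerivWithinAt_of_lipschitzWith hF hC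
    (T := T + 1) (by linarith)
  have hY0 p : Y p 0 = p := (hY p).1
  have hYd p := (hY p).2
  have hYc p : ContinuousOn (Y p) (Icc 0 (T + 1)) := fun s hs => (hYd p s hs).continuousWithinAt
  have hYd' p s (hs : s ∈ Ico 0 (T + 1)) : HasDerivWithinAt (Y p) (F (Y p s)) (Ici s) s :=
    (hYd p s (Ico_subset_Icc_self hs)).mono_of_mem_nhdsWithin (Icc_mem_nhdsGE_of_mem hs)
  have hYlip p q s (hs : s ∈ Icc 0 (T + 1)) :
      dist (Y p s) (Y q s) ≤ dist p q * Real.exp (K * (s - 0)) :=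
    dist_le_of_trajectories_ODE (v := fun _ => F) (fun _ => hF) (hYc p) (hYd' p) (hYc q) (hYd' q)
      (by rw [hY0, hY0]) s hs
  have hYbd p s (hs : s ∈ Icc 0 (T + 1)) : ‖Y p s - p‖ ≤ C * s := by
    simpa [hY0] using norm_image_sub_le_of_norm_deriv_right_le_segment (hYc p) (hYd' p)
      (fun _ _ => hC _) s hs
  have hYℓ p s (hs : s ∈ Icc 0 (T + 1)) : ℓ (Y p s) = ℓ p + s := by
    have := norm_image_sub_le_of_norm_deriv_right_le_segment (f := fun s => ℓ (Y p s) - s)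
      (a := 0) (b := T + 1) (C := 0) (f' := fun s => ℓ (F (Y p s)) - 1)
      ((ℓ.continuous.comp_continuousOn (hYc p)).sub continuousOn_id)
      (fun s hs => ((ℓ.hasFDerivAt.comp_hasDerivWithinAt s (hYd' p s hs)).sub
        (hasDerivWithinAt_id s _)))
      (fun s _ => by simp [hℓ]) s hs
    simp only [hY0, zero_mul, norm_le_zero_iff] at this
    linarith
  have hψY p : ContinuousOn (fun s => ψ (Y p s)) (Icc 0 (T + 1)) :=
    hψ.continuous.comp_continuousOn (hYc p)
  have hint p a b (ha : a ∈ Icc 0 (T + 1)) (hb : b ∈ Icc 0 (T + 1)) :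
      IntervalIntegrable (fun s => ψ (Y p s)) volume a b :=
    ((hψY p).mono (uIcc_subset_Icc ha hb)).intervalIntegrable
  have h0 : (0 : ℝ) ∈ Icc 0 (T + 1) := ⟨le_rfl, by linarith⟩
  have hTm : T ∈ Icc 0 (T + 1) := ⟨hT, by linarith⟩
  refine ⟨fun p => -∫ s in 0..T, ψ (Y p s), (M * Real.exp (K * T) * T).toNNReal, ?_, ?_, ?_⟩
  · refine LipschitzWith.of_dist_le_mul fun p q => ?_
    rw [dist_neg_neg, dist_eq_norm, ← intervalIntegral.integral_sub (hint p _ _ h0 hTm)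
      (hint q _ _ h0 hTm)]
    refine (intervalIntegral.norm_integral_le_of_norm_le_const
      (C := M * (dist p q * Real.exp (K * T))) fun s hs => ?_).trans_eq ?_
    · rw [uIoc_of_le hT] at hs
      rw [← dist_eq_norm]
      refine (hψ.dist_le_mul _ _).trans ?_
      gcongr
      refine (hYlip p q s ⟨hs.1.le, by linarith [hs.2]⟩).trans ?_
      gcongr
      linarith [hs.2]
    · rw [sub_zero, abs_of_nonneg hT]
      rw [Real.coe_toNNReal _ (by positivity)]
      ring
  · intro p hp
    rw [neg_eq_zero]
    refine intervalIntegral.integral_zero_ae (.of_forall fun s hs => hψR _ ?_)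
    rw [uIoc_of_le hT] at hs
    have h1 := hYbd p s ⟨hs.1.le, by linarith [hs.2]⟩
    have h2 := norm_sub_norm_le p (Y p s)
    rw [norm_sub_rev] at h2
    have h3 : C * s ≤ C * T := by gcongr; exact hs.2
    linarith
  · intro p hp hd
    have hsemi s (hs : s ∈ Icc 0 1) r (hr : r ∈ Icc 0 T) : Y (Y p s) r = Y p (r + s) := by
      have hmem : ∀ r ∈ Icc 0 T, r + s ∈ Icc 0 (T + 1) := fun r hr =>
        ⟨add_nonneg hr.1 hs.1, add_le_add hr.2 hs.2⟩
      have := dist_le_of_trajectories_ODE (v := fun _ => F) (fun _ => hF) (δ := 0) (a := 0) (b := T)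
        (f := Y (Y p s)) (g := fun r => Y p (r + s))
        ((hYc _).mono (Icc_subset_Icc_right (by linarith)))
        (fun r hr => hYd' _ r ⟨hr.1, by linarith [hr.2]⟩)
        ((hYc p).comp (by fun_prop) hmem)
        (fun r hr => by
          have := (hYd' p (r + s) ⟨(hmem r (Ico_subset_Icc_self hr)).1,
            by linarith [hr.2, hs.2]⟩).scomp r
            (((hasDerivAt_id r).add_const s).hasDerivWithinAt (s := Ici r))
            (fun x hx => by simpa using hx)
          simpa [Function.comp_def] using this)
        (by simp [hY0]) r hr
      simpa using this
    have hval s (hs : s ∈ Icc 0 1) : -∫ r in 0..T, ψ (Y (Y p s) r) =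
        -((∫ r in 0..T, ψ (Y p r)) - ∫ r in 0..s, ψ (Y p r)) := by
      have e1 : ∫ r in 0..T, ψ (Y (Y p s) r) = ∫ r in 0..T, ψ (Y p (r + s)) :=
        intervalIntegral.integral_congr fun r hr => by
          rw [uIcc_of_le hT] at hr
          simp only [hsemi s hs r hr]
      have hsm : s ∈ Icc 0 (T + 1) := ⟨hs.1, by linarith [hs.2]⟩
      have hTsm : T + s ∈ Icc 0 (T + 1) := ⟨by linarith [hs.1], by linarith [hs.2]⟩
      have e2 : ∫ r in T..(T + s), ψ (Y p r) = 0 :=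
        intervalIntegral.integral_zero_ae (.of_forall fun r hr => hψT _ (by
          rw [uIoc_of_le (by linarith [hs.1])] at hr
          rw [hYℓ p r ⟨by linarith [hr.1], by linarith [hr.2, hs.2]⟩]
          linarith [hr.1]))
      rw [e1, intervalIntegral.integral_comp_add_right (fun r => ψ (Y p r)), zero_add]
      have e3 := intervalIntegral.integral_add_adjacent_intervals (hint p _ _ h0 hsm)
        (hint p _ _ hsm hTsm)
      have e4 := intervalIntegral.integral_add_adjacent_intervals (hint p _ _ h0 hTm)
        (hint p _ _ hTm hTsm)
      linarith
    have hder : HasDerivWithinAt (fun s => -((∫ r in 0..T, ψ (Y p r)) - ∫ r in 0..s, ψ (Y p r)))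
        (ψ p) (Icc 0 1) 0 := by
      have : Fact ((0 : ℝ) ∈ Icc (0 : ℝ) 1) := ⟨by simp⟩
      have h1 : ContinuousOn (fun s => ψ (Y p s)) (Icc 0 1) :=
        (hψY p).mono (Icc_subset_Icc_right (by linarith))
      have h2 := intervalIntegral.integral_hasDerivWithinAt_right (s := Icc (0 : ℝ) 1)
        (t := Icc (0 : ℝ) 1) (hint p 0 0 h0 h0)
        (h1.stronglyMeasurableAtFilter_nhdsWithin measurableSet_Icc 0) (h1 0 (by simp))
      have h3 := (h2.const_sub (∫ r in 0..T, ψ (Y p r))).fun_neg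
      rwa [hY0, neg_neg] at h3
    have hder2 : HasDerivWithinAt (fun s => -∫ r in 0..T, ψ (Y (Y p s) r))
        (ψ p) (Icc 0 1) 0 := hder.congr hval (hval 0 (by simp))
    have hchain := HasFDerivAt.comp_hasDerivWithinAt_of_eq (0 : ℝ) hd.hasFDerivAt
      ((hYd p 0 h0).mono (Icc_subset_Icc_right (show (1:ℝ) ≤ T + 1 by linarith))) (hY0 p).symm
    rw [hY0] at hchain
    exact (uniqueDiffOn_Icc_zero_one 0 (by simp)).eq_deriv _ hchain hder2

open Filter in
/-- A compactly supported Lipschitz function can be approximated by smooth functions with uniformly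
bounded supports and derivatives, the derivatives converging almost everywhere. -/
theorem exists_contDiff_tendsto_fderiv_of_lipschitzWith {E : Type*} [NormedAddCommGroup E]
    [NormedSpace ℝ E] [FiniteDimensional ℝ E] [MeasurableSpace E] [BorelSpace E] (μ : Measure E)
    [μ.IsAddHaarMeasure] {φ : E → ℝ} {L : ℝ≥0} (hφ : LipschitzWith L φ)
    {R : ℝ} (hφR : ∀ p, R < ‖p‖ → φ p = 0) :
    ∃ φ' : ℕ → E → ℝ, (∀ n, ContDiff ℝ (⊤ : ℕ∞) (φ' n)) ∧ (∀ n p, R + 1 < ‖p‖ → φ' n p = 0) ∧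
      (∀ n p, ‖fderiv ℝ (φ' n) p‖ ≤ L) ∧
      ∀ᵐ p ∂μ, Tendsto (fun n => fderiv ℝ (φ' n) p) atTop (𝓝 (fderiv ℝ φ p)) := by
  let b (n : ℕ) : ContDiffBump (0 : E) :=
    { rIn := 1 / ((n : ℝ) + 1) / 2
      rOut := 1 / ((n : ℝ) + 1)
      rIn_pos := by positivity
      rIn_lt_rOut := half_lt_self (by positivity) }
  have hb1 n : (b n).rOut ≤ 1 := by
    show 1 / ((n : ℝ) + 1) ≤ 1
    rw [div_le_one (by positivity)]
    linarith [n.cast_nonneg (α := ℝ)]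
  have hloc : LocallyIntegrable φ μ := hφ.continuous.locallyIntegrable
  have hmeas : Measurable (fderiv ℝ φ) := measurable_fderiv ℝ φ
  have hbound p : ‖fderiv ℝ φ p‖ ≤ L := norm_fderiv_le_of_lipschitz ℝ hφ
  have hloc' : LocallyIntegrable (fderiv ℝ φ) μ :=
    (locallyIntegrable_const (L : ℝ)).mono hmeas.aestronglyMeasurable
      (.of_forall fun p => by simpa using hbound p)
  have hcont n : ContDiff ℝ (⊤ : ℕ∞) ((b n).normed μ) := (b n).contDiff_normed
  have hsmooth n : ContDiff ℝ (⊤ : ℕ∞)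
      (convolution ((b n).normed μ) φ (ContinuousLinearMap.lsmul ℝ ℝ) μ) :=
    (b n).hasCompactSupport_normed.contDiff_convolution_left _ (hcont n) hloc
  have hfd n p : HasFDerivAt (convolution ((b n).normed μ) φ (ContinuousLinearMap.lsmul ℝ ℝ) μ)
      (convolution ((b n).normed μ) (fderiv ℝ φ) (ContinuousLinearMap.lsmul ℝ ℝ) μ p) p := by
    have hae : ∀ᵐ y ∂μ, DifferentiableAt ℝ φ (p - y) :=
      (measurePreserving_sub_left μ p).quasiMeasurePreserving.ae hφ.ae_differentiableAt
    refine (hasFDerivAt_integral_of_dominated_loc_of_lip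
      (F := fun x y => (b n).normed μ y * φ (x - y))
      (F' := fun y => (b n).normed μ y • fderiv ℝ φ (p - y))
      (bound := fun y => (b n).normed μ y * L) univ_mem (.of_forall fun x => ?_) ?_ ?_ ?_ ?_ ?_).2
    · exact ((b n).continuous_normed.mul
        (hφ.continuous.comp (continuous_sub_left x))).aestronglyMeasurable
    · exact ((b n).continuous_normed.mul
        (hφ.continuous.comp (continuous_sub_left p))).integrable_of_hasCompactSupport
          (b n).hasCompactSupport_normed.mul_right
    · exact ((b n).continuous_normed.measurable.smul
        (hmeas.comp (measurable_const_sub p))).aestronglyMeasurable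
    · refine .of_forall fun y => (LipschitzWith.of_dist_le_mul fun x z => ?_).lipschitzOnWith
      have h0 := (b n).nonneg_normed (μ := μ) y
      rw [Real.dist_eq, ← mul_sub, abs_mul, abs_of_nonneg h0, Real.coe_nnabs,
        abs_of_nonneg (mul_nonneg h0 L.coe_nonneg), mul_assoc]
      gcongr
      simpa [Real.dist_eq] using hφ.dist_le_mul (x - y) (z - y)
    · exact (b n).integrable_normed.mul_const _
    · filter_upwards [hae] with y hy
      exact (hy.hasFDerivAt.comp p ((hasFDerivAt_id p).sub_const y)).const_mul _
  refine ⟨fun n => convolution ((b n).normed μ) φ (ContinuousLinearMap.lsmul ℝ ℝ) μ, hsmooth,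
    ?_, ?_, ?_⟩
  · intro n p hp
    refine integral_eq_zero_of_ae (.of_forall fun y => ?_)
    by_cases hy : y ∈ Function.support ((b n).normed μ)
    · rw [(b n).support_normed_eq, mem_ball_zero_iff] at hy
      have : φ (p - y) = 0 := hφR _ (by linarith [norm_sub_norm_le p y, hb1 n])
      simp [this]
    · simp [Function.notMem_support.1 hy]
  · intro n p
    rw [(hfd n p).fderiv]
    refine (norm_integral_le_of_norm_le ((b n).integrable_normed.mul_const (L : ℝ))
      (.of_forall fun y => ?_)).trans_eq ?_
    · have h0 := (b n).nonneg_normed (μ := μ) y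
      rw [ContinuousLinearMap.lsmul_apply, norm_smul, Real.norm_of_nonneg h0]
      gcongr
      exact hbound _
    · rw [integral_mul_const, (b n).integral_normed, one_mul]
  · have h := ContDiffBump.ae_convolution_tendsto_right_of_locallyIntegrable (φ := b) (K := 2)
      (tendsto_one_div_add_atTop_nhds_zero_nat (𝕜 := ℝ))
      (.of_forall fun n => (mul_div_cancel₀ _ two_ne_zero).ge) hloc'
    filter_upwards [h] with p hp
    simpa only [(hfd _ p).fderiv] using hp

open Filter in
/-- If the weak formulation of a transport equation with bounded continuous field `F` holds for
smooth test functions, then it holds for Lipschitz ones. -/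
theorem integral_mul_fderiv_apply_eq_zero_of_lipschitzWith {E : Type*} [NormedAddCommGroup E]
    [NormedSpace ℝ E] [FiniteDimensional ℝ E] [MeasurableSpace E] [BorelSpace E] {μ : Measure E}
    [μ.IsAddHaarMeasure] {F : E → E} {C : ℝ} (hF : Continuous F) (hC : ∀ x, ‖F x‖ ≤ C)
    {S : Set E} (hS : IsClosed S) {w : E → ℝ} (hw : LocallyIntegrableOn w S μ)
    (hweak : ∀ φ : E → ℝ, ContDiff ℝ (⊤ : ℕ∞) φ → HasCompactSupport φ →
      ∫ p in S, w p * fderiv ℝ φ p (F p) ∂μ = 0)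
    {φ : E → ℝ} {L : ℝ≥0} (hφ : LipschitzWith L φ) {R : ℝ} (hφR : ∀ p, R < ‖p‖ → φ p = 0) :
    ∫ p in S, w p * fderiv ℝ φ p (F p) ∂μ = 0 := by
  obtain ⟨φ', hsm, hsupp, hbd, hlim⟩ :=
    exists_contDiff_tendsto_fderiv_of_lipschitzWith μ hφ hφR
  have hcs n : HasCompactSupport (φ' n) :=
    .intro (isCompact_closedBall (0 : E) (R + 1)) fun p hp => hsupp n p (by simpa using hp)
  have hC0 : 0 ≤ C := (norm_nonneg _).trans (hC 0)
  have hw_int : IntegrableOn w (S ∩ Metric.closedBall 0 (R + 1)) μ :=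
    hw.integrableOn_compact_subset inter_subset_left
      ((isCompact_closedBall _ _).inter_left hS)
  have hsupp' n p (hp : R + 1 < ‖p‖) : fderiv ℝ (φ' n) p = 0 := by
    have : φ' n =ᶠ[𝓝 p] fun _ => 0 := by
      filter_upwards [(isOpen_lt continuous_const continuous_norm).mem_nhds hp] with q hq
        using hsupp n q hq
    rw [this.fderiv_eq]
    simp
  have hwm : AEStronglyMeasurable w (μ.restrict S) := hw.aestronglyMeasurable
  have h := tendsto_integral_of_dominated_convergence (μ := μ.restrict S)
    (F := fun n p => w p * fderiv ℝ (φ' n) p (F p)) (f := fun p => w p * fderiv ℝ φ p (F p))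
    (fun p => (Metric.closedBall 0 (R + 1)).indicator (fun p => ‖w p‖ * (L * C)) p)
    (fun n => hwm.mul
      (((hsm n).continuous_fderiv (by simp)).clm_apply hF).aestronglyMeasurable) ?_
    (fun n => .of_forall fun p => ?_) ?_
  · simp only [hweak _ (hsm _) (hcs _)] at h
    exact (tendsto_nhds_unique h tendsto_const_nhds)
  · rw [integrable_indicator_iff Metric.isClosed_closedBall.measurableSet, IntegrableOn,
      Measure.restrict_restrict Metric.isClosed_closedBall.measurableSet, inter_comm]
    exact hw_int.norm.mul_const _
  · by_cases hp : p ∈ Metric.closedBall (0 : E) (R + 1)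
    · rw [indicator_of_mem hp, norm_mul]
      gcongr
      exact (ContinuousLinearMap.le_opNorm _ _).trans (by gcongr; exacts [hbd n p, hC p])
    · rw [indicator_of_notMem hp, hsupp' n p (by simpa using hp)]
      simp
  · filter_upwards [ae_restrict_of_ae hlim] with p hp
    exact ((ContinuousLinearMap.apply ℝ ℝ (F p)).continuous.tendsto _ |>.comp hp).const_mul _

/-- The weak formulation as a single integral over the closed half-space, in terms of the
space-time field `(V, 1)`. -/
theorem IsWeakSol.integral_mul_fderiv_eq {d : ℕ} {V : Euc d → ℝ → Euc d} {u0 : Euc d → ℝ}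
    {u : Euc d → ℝ → ℝ} (hu : IsWeakSol d V u0 u)
    (hV : Continuous fun p : Euc d × ℝ => V p.1 p.2)
    {φ : Euc d × ℝ → ℝ} (hφ : ContDiff ℝ (⊤ : ℕ∞) φ) (hφc : HasCompactSupport φ) :
    IntegrableOn (fun p : Euc d × ℝ => u p.1 p.2 * fderiv ℝ φ p (V p.1 p.2, 1)) {p | 0 ≤ p.2} ∧
    ∫ p in {p : Euc d × ℝ | 0 ≤ p.2}, u p.1 p.2 * fderiv ℝ φ p (V p.1 p.2, 1) =
      -∫ x : Euc d, u0 x * φ (x, 0) := by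
  have hS : IsClosed {p : Euc d × ℝ | 0 ≤ p.2} := isClosed_le continuous_const continuous_snd
  have hcont : Continuous fun p : Euc d × ℝ => fderiv ℝ φ p (V p.1 p.2, 1) :=
    (hφ.continuous_fderiv (by simp)).clm_apply (hV.prodMk continuous_const)
  have hsupp : HasCompactSupport fun p : Euc d × ℝ => fderiv ℝ φ p (V p.1 p.2, 1) :=
    (hφc.fderiv ℝ).mono fun p hp h => hp (by simp [h])
  have hint : IntegrableOn (fun p : Euc d × ℝ => u p.1 p.2 * fderiv ℝ φ p (V p.1 p.2, 1))
      {p | 0 ≤ p.2} := by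
    have h1 : IntegrableOn (fun p : Euc d × ℝ => u p.1 p.2 * fderiv ℝ φ p (V p.1 p.2, 1))
        ({p | 0 ≤ p.2} ∩ tsupport fun p : Euc d × ℝ => fderiv ℝ φ p (V p.1 p.2, 1)) :=
      (hu.1.integrableOn_compact_subset inter_subset_left
        (hsupp.isCompact.inter_left hS)).mul_continuousOn hcont.continuousOn
        (hsupp.isCompact.inter_left hS)
    refine h1.of_forall_sdiff_eq_zero hS.measurableSet fun p hp => ?_
    rw [image_eq_zero_of_notMem_tsupport fun h => hp.2 ⟨hp.1, h⟩, mul_zero]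
  refine ⟨hint, ?_⟩
  have hrestr : (volume : Measure (Euc d × ℝ)).restrict {p | 0 ≤ p.2} =
      (volume : Measure (Euc d)).prod (volume.restrict (Ioi 0)) := by
    have : {p : Euc d × ℝ | 0 ≤ p.2} = univ ×ˢ Ici 0 := by ext; simp
    rw [this, volume_eq_prod, ← Measure.prod_restrict, Measure.restrict_univ,
      restrict_Ioi_eq_restrict_Ici]
  rw [IntegrableOn, hrestr] at hint
  rw [hrestr, integral_prod_symm _ hint, eq_neg_iff_add_eq_zero]
  refine Eq.trans ?_ (hu.2 φ hφ hφc)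
  congr! 7 with t x
  rw [← map_add]
  simp

/-- **Uniqueness of weak solutions** of the linear advection equation
`∂ₜ u + div (V u) = 0`, `u(·,0) = u0`, for a bounded, Lipschitz, divergence-free
speed `V` and `u0 ∈ L¹_loc(ℝ^d)`: two weak solutions with the same initial datum
coincide almost everywhere on `ℝ^d × (0,∞)`. -/
theorem uniqueness_of_weak_solutions (d : ℕ) (hd : 1 ≤ d)
    (V : Euc d → ℝ → Euc d) (CV : ℝ) (LV : ℝ≥0)
    (hVbdd : ∀ x t, ‖V x t‖ ≤ CV)
    (hVlip : LipschitzWith LV (fun p : Euc d × ℝ => V p.1 p.2))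
    (hVdiv : DivFree d V)
    (u0 : Euc d → ℝ) (hu0 : LocallyIntegrable u0)
    (u v : Euc d → ℝ → ℝ)
    (hu : IsWeakSol d V u0 u) (hv : IsWeakSol d V u0 v) :
    (fun p : Euc d × ℝ => u p.1 p.2)
      =ᵐ[volume.restrict {p : Euc d × ℝ | 0 < p.2}]
    (fun p : Euc d × ℝ => v p.1 p.2) := by
  have : (volume : Measure (Euc d × ℝ)).IsAddHaarMeasure :=
    inferInstanceAs ((volume : Measure (Euc d)).prod (volume : Measure ℝ)).IsAddHaarMeasure
  have hU : IsOpen {p : Euc d × ℝ | 0 < p.2} := isOpen_lt continuous_const continuous_snd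
  have hS : IsClosed {p : Euc d × ℝ | 0 ≤ p.2} := isClosed_le continuous_const continuous_snd
  have hUS : {p : Euc d × ℝ | 0 < p.2} ⊆ {p | 0 ≤ p.2} := fun p (hp : 0 < p.2) => hp.le
  have hF : LipschitzWith (max LV 0) fun p : Euc d × ℝ => (V p.1 p.2, (1 : ℝ)) :=
    hVlip.prodMk (LipschitzWith.const 1)
  have hC (p : Euc d × ℝ) : ‖(V p.1 p.2, (1 : ℝ))‖ ≤ max CV.toNNReal 1 := by
    rw [Prod.norm_mk, norm_one, NNReal.coe_max, NNReal.coe_one]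
    exact max_le_max_right _ ((hVbdd _ _).trans (Real.le_coe_toNNReal _))
  have hw := hu.1.sub hv.1
  have key := hU.ae_eq_zero_of_integral_contDiff_smul_eq_zero (μ := volume) (hw.mono_set hUS) ?_
  · rw [Filter.EventuallyEq, ae_restrict_iff' hU.measurableSet]
    filter_upwards [key] with p hp h0 using sub_eq_zero.1 (hp h0)
  intro ψ hψ hψc hψU
  obtain ⟨M, hM⟩ := hψ.lipschitzWith_of_hasCompactSupport hψc (by simp)
  obtain ⟨R, hR⟩ := hψc.isCompact.isBounded.subset_closedBall (0 : Euc d × ℝ)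
  have hψR (p : Euc d × ℝ) (hp : R < ‖p‖) : ψ p = 0 :=
    image_eq_zero_of_notMem_tsupport fun h => by simpa [hp.not_ge] using hR h
  obtain ⟨φ, L, hφ, hφR, hφeq⟩ := exists_lipschitzWith_fderiv_apply_eq hF hC
    (ContinuousLinearMap.snd ℝ (Euc d) ℝ) (fun _ => rfl) hM hψR (T := |R| + 1) (by positivity)
    (fun p hp => hψR p (by
      have h1 : p.2 ≤ ‖p‖ := (le_abs_self _).trans (norm_snd_le p)
      have h2 : |R| + 1 ≤ p.2 := hp
      linarith [le_abs_self R]))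
  have hweak := integral_mul_fderiv_apply_eq_zero_of_lipschitzWith hF.continuous hC hS hw
    (fun φ hφ hφc => by
      obtain ⟨hui, hue⟩ := hu.integral_mul_fderiv_eq hVlip.continuous hφ hφc
      obtain ⟨hvi, hve⟩ := hv.integral_mul_fderiv_eq hVlip.continuous hφ hφc
      simp only [Pi.sub_apply, sub_mul]
      rw [integral_sub hui hvi, hue, hve, sub_self]) hφ hφR
  rw [← hweak, ← setIntegral_eq_integral_of_forall_compl_eq_zero (s := {p | 0 ≤ p.2})
    (fun p hp => by
      rw [image_eq_zero_of_notMem_tsupport fun h => hp (hUS (hψU h)), zero_smul])]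
  have hae : ∀ᵐ p : Euc d × ℝ, p.2 ≠ 0 := by
    have := (quasiMeasurePreserving_snd (μ := (volume : Measure (Euc d)))
      (ν := (volume : Measure ℝ))).ae (Measure.ae_ne volume 0)
    exact this
  refine setIntegral_congr_ae hS.measurableSet ?_
  filter_upwards [hae, hφ.ae_differentiableAt] with p hp0 hpd hp
  rw [hφeq p (lt_of_le_of_ne hp hp0.symm) hpd, smul_eq_mul, mul_comm]
end
end

section
/- For every u0 ∈ L^1_loc(ℝ^d), the function u(x,t) := u0(X(x,t)) is a weak solution of the linear advection problem with initial datum u0. -/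
open MeasureTheory Measure Set
open scoped ENNReal NNReal InnerProductSpace Topology

noncomputable section

open Filter

theorem differentiable_det (d : ℕ) :
    Differentiable ℝ (fun A : Euc d →L[ℝ] Euc d => A.det) := by
  have h : (fun A : Euc d →L[ℝ] Euc d => A.det) = fun A =>
      ∑ σ : Equiv.Perm (Fin d), (Equiv.Perm.sign σ : ℝ) *
        ∏ i, (A (EuclideanSpace.single i 1)) (σ i) := by
    funext A
    rw [ContinuousLinearMap.det,
      ← LinearMap.det_toMatrix (EuclideanSpace.basisFun (Fin d) ℝ).toBasis, Matrix.det_apply']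
    simp [LinearMap.toMatrix_apply]
  rw [h]
  have hentry : ∀ i j : Fin d, Differentiable ℝ
      (fun A : Euc d →L[ℝ] Euc d => (A (EuclideanSpace.single i 1)) j) := fun i j =>
    ((EuclideanSpace.proj j : Euc d →L[ℝ] ℝ).comp
      (ContinuousLinearMap.apply ℝ (Euc d) (EuclideanSpace.single i (1 : ℝ)))).differentiable
  fun_prop

theorem fderiv_det_one (d : ℕ) (B : Euc d →L[ℝ] Euc d) :
    fderiv ℝ (fun A : Euc d →L[ℝ] Euc d => A.det) 1 B =
      ∑ i, (B (EuclideanSpace.single i 1)) i := by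
  have h1 : HasDerivAt (fun r : ℝ => (1 + r • B).det)
      (fderiv ℝ (fun A : Euc d →L[ℝ] Euc d => A.det) 1 B) 0 := by
    have hl : HasDerivAt (fun r : ℝ => 1 + r • B) B 0 := by
      simpa using ((hasDerivAt_id (0 : ℝ)).smul_const B).const_add 1
    have h0 : (1 : Euc d →L[ℝ] Euc d) = 1 + (0 : ℝ) • B := by ext; simp
    exact (differentiable_det d 1).hasFDerivAt.comp_hasDerivAt_of_eq (0 : ℝ) hl h0
  set M := LinearMap.toMatrix (EuclideanSpace.basisFun (Fin d) ℝ).toBasis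
    (EuclideanSpace.basisFun (Fin d) ℝ).toBasis (B : Euc d →ₗ[ℝ] Euc d) with hM
  have h2 : (fun r : ℝ => (1 + r • B).det) = fun r => 1 + M.trace * r +
      (Matrix.det (1 + (Polynomial.X : Polynomial ℝ) • M.map Polynomial.C)).divX.divX.eval r
        * r ^ 2 := by
    funext r
    rw [← Matrix.det_one_add_smul, hM, ContinuousLinearMap.det,
      ← LinearMap.det_toMatrix (EuclideanSpace.basisFun (Fin d) ℝ).toBasis]
    congr 1
    ext i j
    simp [LinearMap.toMatrix_apply, Matrix.one_apply]
  have h3 : HasDerivAt (fun r : ℝ => (1 + r • B).det) M.trace 0 := by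
    rw [h2]
    set p := (Matrix.det (1 + (Polynomial.X : Polynomial ℝ) • M.map Polynomial.C)).divX.divX
    have := (((hasDerivAt_id (0 : ℝ)).const_mul M.trace).const_add 1).add
      ((p.hasDerivAt 0).mul ((hasDerivAt_id (0 : ℝ)).pow 2))
    exact this.congr_deriv (by simp)
  rw [h1.unique h3]
  simp [Matrix.trace, hM, LinearMap.toMatrix_apply]

/-- The determinant of a trace-free perturbation of the identity is `1` to first order. -/
theorem exists_abs_abs_det_one_add_sub_one_le (d : ℕ) {ε : ℝ} (hε : 0 < ε) :
    ∃ δ > 0, ∀ B : Euc d →L[ℝ] Euc d, ‖B‖ ≤ δ →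
      ∑ i, (B (EuclideanSpace.single i 1)) i = 0 → |(|(1 + B).det| - 1)| ≤ ε * ‖B‖ := by
  have h := (differentiable_det d 1).hasFDerivAt.isLittleO.def hε
  obtain ⟨δ, hδ, H⟩ := Metric.eventually_nhds_iff.1 h
  refine ⟨δ / 2, by positivity, fun B hB htr => ?_⟩
  have := @H (1 + B) (by simp; linarith)
  rw [add_sub_cancel_left, fderiv_det_one, htr] at this
  have h1 : (1 : Euc d →L[ℝ] Euc d).det = 1 := by simp [ContinuousLinearMap.det]
  rw [h1, sub_zero, Real.norm_eq_abs] at this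
  calc |(|(1 + B).det| - 1)| = |(|(1 + B).det| - |1|)| := by simp
    _ ≤ |(1 + B).det - 1| := abs_abs_sub_abs_le _ _
    _ ≤ _ := this

/-- A Lipschitz vector field that is divergence-free in the sense of distributions has
vanishing pointwise divergence almost everywhere. -/
theorem ae_sum_fderiv_eq_zero {d : ℕ} {v : Euc d → Euc d} {L : ℝ≥0} (hv : LipschitzWith L v)
    (hdiv : ∀ ψ : Euc d → ℝ, ContDiff ℝ (⊤ : ℕ∞) ψ → HasCompactSupport ψ →
      ∫ x : Euc d, fderiv ℝ ψ x (v x) = 0) :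
    ∀ᵐ x, ∑ i, (fderiv ℝ v x (EuclideanSpace.single i 1)) i = 0 := by
  have hmeas : Measurable
      fun x => ∑ i, (fderiv ℝ v x (EuclideanSpace.single i (1 : ℝ))) i := by
    refine Finset.measurable_sum _ fun i _ => ?_
    have h := measurable_fderiv_apply_const ℝ v (EuclideanSpace.single i (1 : ℝ))
    exact (EuclideanSpace.proj i : Euc d →L[ℝ] ℝ).measurable.comp h
  have hcomp : ∀ i, LipschitzWith L (fun x => v x i) := fun i => by
    refine LipschitzWith.of_dist_le_mul fun x y => ?_
    refine le_trans ?_ (hv.dist_le_mul x y)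
    rw [dist_eq_norm, dist_eq_norm]
    exact PiLp.norm_apply_le (v x - v y) i
  have hbound : ∀ x i, |(fderiv ℝ v x (EuclideanSpace.single i (1 : ℝ))) i| ≤ L := fun x i =>
    calc |(fderiv ℝ v x (EuclideanSpace.single i (1 : ℝ))) i|
        ≤ ‖fderiv ℝ v x (EuclideanSpace.single i (1 : ℝ))‖ :=
          (Real.norm_eq_abs _).symm.trans_le (PiLp.norm_apply_le _ i)
      _ ≤ ‖fderiv ℝ v x‖ * ‖EuclideanSpace.single i (1 : ℝ)‖ :=
          ContinuousLinearMap.le_opNorm _ _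
      _ ≤ L := by simpa using norm_fderiv_le_of_lipschitz ℝ hv
  have hline : ∀ᵐ x, ∀ i, lineDeriv ℝ (fun y => v y i) x (EuclideanSpace.single i 1) =
      (fderiv ℝ v x (EuclideanSpace.single i 1)) i := by
    filter_upwards [hv.ae_differentiableAt] with x hx i
    have h := ((EuclideanSpace.proj i : Euc d →L[ℝ] ℝ).hasFDerivAt.comp x hx.hasFDerivAt)
    exact (h.hasLineDerivAt (EuclideanSpace.single i 1)).lineDeriv
  refine ae_eq_zero_of_integral_contDiff_smul_eq_zero ?_ fun ψ hψ hψc => ?_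
  · refine (locallyIntegrable_const (d * L : ℝ)).mono hmeas.aestronglyMeasurable
      (Eventually.of_forall fun x => ?_)
    calc ‖∑ i, (fderiv ℝ v x (EuclideanSpace.single i 1)) i‖ ≤ ∑ i : Fin d, (L : ℝ) :=
          norm_sum_le_of_le _ fun i _ => hbound x i
      _ = d * L := by simp
      _ ≤ _ := le_abs_self _
  · obtain ⟨D, hD⟩ := hψ.lipschitzWith_of_hasCompactSupport hψc (by simp)
    have hdiff : Differentiable ℝ ψ := hψ.differentiable (by simp)
    have key : ∀ i, ∫ x, ψ x * (fderiv ℝ v x (EuclideanSpace.single i 1)) i =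
        - ∫ x, fderiv ℝ ψ x (EuclideanSpace.single i 1) * v x i := fun i => by
      have h := (hcomp i).integral_lineDeriv_mul_eq (μ := volume) hD hψc
        (EuclideanSpace.single i (1 : ℝ))
      rw [← integral_neg]
      calc _ = ∫ x, lineDeriv ℝ (fun y => v y i) x (EuclideanSpace.single i 1) * ψ x :=
            integral_congr_ae (by filter_upwards [hline] with x hx; rw [hx i, mul_comm])
        _ = _ := h
        _ = _ := by
            congr 1; ext x
            rw [(hdiff x).lineDeriv_eq_fderiv, map_neg, neg_mul]
    have hint : ∀ i ∈ Finset.univ, Integrable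
        (fun x => ψ x * (fderiv ℝ v x (EuclideanSpace.single i 1)) i) := fun i _ => by
      refine (hψ.continuous.integrable_of_hasCompactSupport hψc).mul_bdd (c := L) ?_ ?_
      · exact ((EuclideanSpace.proj i : Euc d →L[ℝ] ℝ).measurable.comp
          (measurable_fderiv_apply_const ℝ v _)).aestronglyMeasurable
      · exact Eventually.of_forall fun x => hbound x i
    have hint' : ∀ i ∈ Finset.univ, Integrable
        (fun x => fderiv ℝ ψ x (EuclideanSpace.single i 1) * v x i) := fun i _ => by
      refine Continuous.integrable_of_hasCompactSupport ?_ ?_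
      · exact ((hψ.continuous_fderiv (by simp)).clm_apply continuous_const).mul
          (hcomp i).continuous
      · exact (hψc.fderiv_apply ℝ _).mul_right
    simp only [smul_eq_mul, Finset.mul_sum]
    rw [integral_finsetSum _ hint, Finset.sum_congr rfl fun i _ => key i,
      Finset.sum_neg_distrib, ← integral_finsetSum _ hint', ← hdiv ψ hψ hψc, neg_eq_iff_eq_neg,
      hdiv ψ hψ hψc]
    rw [neg_zero, ← hdiv ψ hψ hψc]
    congr 1; ext x
    conv_rhs => rw [← (EuclideanSpace.basisFun (Fin d) ℝ).sum_repr (v x)]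
    simp [mul_comm]

/-- One explicit Euler step along a divergence-free Lipschitz field preserves integrals up to an
error that is negligible with respect to the step size. -/
theorem exists_abs_integral_euler_step_sub_le (d : ℕ) (L : ℝ≥0) {ε : ℝ} (hε : 0 < ε) :
    ∃ δ > 0, ∀ v : Euc d → Euc d, LipschitzWith L v →
      (∀ ψ : Euc d → ℝ, ContDiff ℝ (⊤ : ℕ∞) ψ → HasCompactSupport ψ →
        ∫ x : Euc d, fderiv ℝ ψ x (v x) = 0) →
      ∀ h : ℝ, 0 < h → h < δ → ∀ f : Euc d → ℝ, Continuous f → HasCompactSupport f →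
        |(∫ x, f (x + h • v x)) - ∫ x, f x| ≤ ε * h * ∫ x, |f x| := by
  have hid : ENNReal.ofReal |(ContinuousLinearMap.id ℝ (Euc d)).det| < (2 : ℝ≥0) := by
    simp [ContinuousLinearMap.det]
  obtain ⟨δ₁, hδ₁, hδ₁pos⟩ :=
    ((addHaar_image_le_mul_of_det_lt (volume : Measure (Euc d)) _ hid).and
      self_mem_nhdsWithin).exists
  replace hδ₁pos : (0 : ℝ) < δ₁ := hδ₁pos
  obtain ⟨δ₂, hδ₂, hdet⟩ := exists_abs_abs_det_one_add_sub_one_le d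
    (show 0 < ε / (2 * (L + 1)) by positivity)
  set m := min (1 / 2 : ℝ) (min δ₁ δ₂) with hm
  have hmpos : 0 < m := by positivity
  refine ⟨min (m / (L + 1)) (1 / ε), by positivity, fun v hv hdiv h hpos hlt f hf hfc => ?_⟩
  have hLm : h * L ≤ m := by
    have h1 : h < m / (L + 1) := hlt.trans_le (min_le_left _ _)
    rw [lt_div_iff₀ (by positivity)] at h1
    nlinarith
  have hhalf : h * L ≤ 1 / 2 := hLm.trans (min_le_left _ _)
  have hle₁ : h * L ≤ δ₁ := hLm.trans ((min_le_right _ _).trans (min_le_left _ _))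
  have hle₂ : h * L ≤ δ₂ := hLm.trans ((min_le_right _ _).trans (min_le_right _ _))
  have hεh : ε * h ≤ 1 := by
    have h1 : h < 1 / ε := hlt.trans_le (min_le_right _ _)
    rw [lt_div_iff₀ hε] at h1
    linarith
  set Φ : Euc d → Euc d := fun x => x + h • v x with hΦ
  have happrox : ApproximatesLinearOn Φ
      ((ContinuousLinearEquiv.refl ℝ (Euc d) : Euc d ≃L[ℝ] Euc d) : Euc d →L[ℝ] Euc d) univ
      (h.toNNReal * L) := by
    intro x _ y _
    have h1 : Φ x - Φ y - (x - y) = h • (v x - v y) := by simp only [hΦ, smul_sub]; abel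
    have h2 := hv.dist_le_mul x y
    rw [dist_eq_norm, dist_eq_norm] at h2
    simp only [ContinuousLinearEquiv.coe_refl, ContinuousLinearMap.coe_id', id_eq, h1, norm_smul,
      Real.norm_eq_abs, abs_of_pos hpos, NNReal.coe_mul, Real.coe_toNNReal h hpos.le]
    rw [mul_assoc]
    gcongr
  have hc : Subsingleton (Euc d) ∨ h.toNNReal * L <
      ‖((ContinuousLinearEquiv.refl ℝ (Euc d)).symm : Euc d →L[ℝ] Euc d)‖₊⁻¹ := by
    rcases subsingleton_or_nontrivial (Euc d) with hs | hs
    · exact Or.inl hs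
    · right
      have h1 : ‖((ContinuousLinearEquiv.refl ℝ (Euc d)).symm : Euc d →L[ℝ] Euc d)‖₊ = 1 :=
        NNReal.eq (ContinuousLinearMap.norm_id)
      rw [h1, inv_one, ← NNReal.coe_lt_coe]
      simp only [NNReal.coe_mul, Real.coe_toNNReal h hpos.le, NNReal.coe_one]
      linarith
  have hΦhomeo : ∀ x, happrox.toHomeomorph Φ hc x = Φ x := fun _ => rfl
  have hΦinj : Function.Injective Φ := (happrox.toHomeomorph Φ hc).injective
  have hΦsurj : Function.Surjective Φ := (happrox.toHomeomorph Φ hc).surjective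
  have hfΦ : Continuous fun x => f (Φ x) := hf.comp (happrox.toHomeomorph Φ hc).continuous
  have hfΦc : HasCompactSupport fun x => f (Φ x) :=
    hfc.comp_homeomorph (happrox.toHomeomorph Φ hc)
  have hfΦint : Integrable fun x => f (Φ x) := hfΦ.integrable_of_hasCompactSupport hfΦc
  set s : Set (Euc d) := {x | DifferentiableAt ℝ v x} with hs
  have hsm : MeasurableSet s := measurableSet_of_differentiableAt ℝ v
  have hsnull : volume sᶜ = 0 := hv.ae_differentiableAt
  have himage : (volume : Measure (Euc d)) (Φ '' s)ᶜ = 0 := by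
    rw [← image_compl_eq ⟨hΦinj, hΦsurj⟩]
    have happ : ApproximatesLinearOn Φ (ContinuousLinearMap.id ℝ (Euc d)) sᶜ δ₁ := by
      refine (happrox.mono_set (subset_univ _)).mono_num ?_
      rw [← NNReal.coe_le_coe]
      simpa [Real.coe_toNNReal h hpos.le] using hle₁
    have := hδ₁ sᶜ Φ happ
    rw [hsnull, mul_zero] at this
    exact le_antisymm this (zero_le)
  set J : Euc d → ℝ := fun x => |(1 + h • fderiv ℝ v x).det| with hJ
  have hcov : ∀ g : Euc d → ℝ, ∫ x, g x = ∫ x, J x * g (Φ x) := fun g => by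
    have hderiv : ∀ x ∈ s, HasFDerivWithinAt Φ (1 + h • fderiv ℝ v x) s x := fun x hx =>
      ((hasFDerivAt_id x).add ((show DifferentiableAt ℝ v x from hx).hasFDerivAt.const_smul
        h)).hasFDerivWithinAt
    have h1 := integral_image_eq_integral_abs_det_fderiv_smul volume hsm hderiv hΦinj.injOn g
    rwa [setIntegral_congr_set (ae_eq_univ.2 himage), setIntegral_univ,
      setIntegral_congr_set (ae_eq_univ.2 hsnull), setIntegral_univ] at h1
  have hJm : Measurable J :=
    ((differentiable_det d).continuous.measurable.comp
      (((measurable_fderiv ℝ v).const_smul h).const_add 1)).abs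
  have hJ1 : ∀ᵐ x, |J x - 1| ≤ ε / 2 * h := by
    filter_upwards [ae_sum_fderiv_eq_zero hv hdiv] with x hx
    have hnorm : ‖h • fderiv ℝ v x‖ ≤ h * L := by
      rw [norm_smul, Real.norm_eq_abs, abs_of_pos hpos]
      gcongr
      exact norm_fderiv_le_of_lipschitz ℝ hv
    refine (hdet (h • fderiv ℝ v x) (hnorm.trans hle₂) ?_).trans ?_
    · simp [← Finset.mul_sum, hx]
    · calc ε / (2 * (L + 1)) * ‖h • fderiv ℝ v x‖ ≤ ε / (2 * (L + 1)) * (h * (L + 1)) := by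
            gcongr
            linarith
        _ = ε / 2 * h := by field_simp
  have hJ2 : ∀ᵐ x, 1 / 2 ≤ J x ∧ ‖J x‖ ≤ 2 := by
    filter_upwards [hJ1] with x hx
    have := abs_le.1 hx
    refine ⟨by linarith, ?_⟩
    rw [Real.norm_eq_abs, abs_le]
    constructor <;> linarith
  have hJf : Integrable fun x => J x * f (Φ x) :=
    hfΦint.bdd_mul hJm.aestronglyMeasurable (hJ2.mono fun x hx => hx.2)
  have hJaf : Integrable fun x => J x * |f (Φ x)| :=
    hfΦint.abs.bdd_mul hJm.aestronglyMeasurable (hJ2.mono fun x hx => hx.2)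
  have habs : ∫ x, |f (Φ x)| ≤ 2 * ∫ x, |f x| := by
    have h1 : ∫ x, 1 / 2 * |f (Φ x)| ≤ ∫ x, J x * |f (Φ x)| := by
      refine integral_mono_ae (hfΦint.abs.const_mul _) hJaf ?_
      filter_upwards [hJ2] with x hx
      exact mul_le_mul_of_nonneg_right hx.1 (abs_nonneg _)
    rw [integral_const_mul, ← hcov fun x => |f x|] at h1
    linarith
  have hsub : (∫ x, f (Φ x)) - ∫ x, f x = ∫ x, (f (Φ x) - J x * f (Φ x)) := by
    rw [hcov f, integral_sub hfΦint hJf]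
  rw [hsub, ← Real.norm_eq_abs]
  calc _ ≤ ∫ x, ε / 2 * h * |f (Φ x)| := by
        refine norm_integral_le_of_norm_le (hfΦint.abs.const_mul _) ?_
        filter_upwards [hJ1] with x hx
        have h1 : f (Φ x) - J x * f (Φ x) = -((J x - 1) * f (Φ x)) := by ring
        rw [h1, norm_neg, norm_mul, Real.norm_eq_abs, Real.norm_eq_abs]
        gcongr
    _ = ε / 2 * h * ∫ x, |f (Φ x)| := integral_const_mul _ _
    _ ≤ ε / 2 * h * (2 * ∫ x, |f x|) := by gcongr
    _ = ε * h * ∫ x, |f x| := by ring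

theorem abs_integral_sub_integral_le {d : ℕ} {f g : Euc d → ℝ} {c R : ℝ}
    (hf : Integrable f) (hg : Integrable g) (hle : ∀ x, |f x - g x| ≤ c)
    (hsupp : ∀ x, R < ‖x‖ → f x = 0 ∧ g x = 0) :
    |(∫ x, f x) - ∫ x, g x| ≤ c * volume.real (Metric.closedBall (0 : Euc d) R) := by
  rw [← integral_sub hf hg, ← setIntegral_eq_integral_of_forall_compl_eq_zero
    (s := Metric.closedBall (0 : Euc d) R), ← Real.norm_eq_abs]
  · exact norm_setIntegral_le_of_norm_le_const measure_closedBall_lt_top fun x _ => hle x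
  · intro x hx
    have := hsupp x (by simpa using hx)
    simp [this.1, this.2]

/-- `Y` is the forward flow of the vector field `V`, which is bounded by `CV` and
`LV`-Lipschitz. -/
structure IsForwardFlow {d : ℕ} (V : Euc d → ℝ → Euc d) (CV : ℝ) (LV : ℝ≥0)
    (Y : Euc d → ℝ → Euc d) : Prop where
  norm_le : ∀ x t, ‖V x t‖ ≤ CV
  lipschitz : LipschitzWith LV (fun p : Euc d × ℝ => V p.1 p.2)
  zero : ∀ x, Y x 0 = x
  deriv : ∀ x, ∀ t : ℝ, 0 ≤ t → HasDerivWithinAt (Y x) (V (Y x t) t) (Ici 0) t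

namespace IsForwardFlow

variable {d : ℕ} {V : Euc d → ℝ → Euc d} {CV : ℝ} {LV : ℝ≥0} {Y X : Euc d → ℝ → Euc d}

theorem bound_nonneg (hY : IsForwardFlow V CV LV Y) : 0 ≤ CV :=
  (norm_nonneg _).trans (hY.norm_le 0 0)

theorem lipschitz_slice (hY : IsForwardFlow V CV LV Y) (t : ℝ) :
    LipschitzWith LV fun x => V x t := by
  refine LipschitzWith.of_dist_le_mul fun x y => ?_
  simpa [Prod.dist_eq] using hY.lipschitz.dist_le_mul (x, t) (y, t)

theorem hasDerivWithinAt_Ici (hY : IsForwardFlow V CV LV Y) (x : Euc d) {t : ℝ} (ht : 0 ≤ t) :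
    HasDerivWithinAt (Y x) (V (Y x t) t) (Ici t) t :=
  (hY.deriv x t ht).mono (Ici_subset_Ici.2 ht)

theorem continuousOn (hY : IsForwardFlow V CV LV Y) (x : Euc d) : ContinuousOn (Y x) (Ici 0) :=
  fun t ht => (hY.deriv x t ht).continuousWithinAt

theorem continuousOn_Icc (hY : IsForwardFlow V CV LV Y) (x : Euc d) {s t : ℝ} (hs : 0 ≤ s) :
    ContinuousOn (Y x) (Icc s t) :=
  (hY.continuousOn x).mono fun _ hr => hs.trans hr.1

theorem norm_sub_le (hY : IsForwardFlow V CV LV Y) (x : Euc d) {s t : ℝ} (hs : 0 ≤ s)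
    (hst : s ≤ t) : ‖Y x t - Y x s‖ ≤ CV * (t - s) :=
  norm_image_sub_le_of_norm_deriv_right_le_segment (hY.continuousOn_Icc x hs)
    (fun _ hr => hY.hasDerivWithinAt_Ici x (hs.trans hr.1)) (fun _ _ => hY.norm_le _ _) t
    (right_mem_Icc.2 hst)

theorem dist_le (hY : IsForwardFlow V CV LV Y) (x y : Euc d) {s t : ℝ} (hs : 0 ≤ s)
    (hst : s ≤ t) : dist (Y x t) (Y y t) ≤ dist (Y x s) (Y y s) * Real.exp (LV * (t - s)) :=
  dist_le_of_trajectories_ODE (v := fun t x => V x t) hY.lipschitz_slice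
    (hY.continuousOn_Icc x hs) (fun _ hr => hY.hasDerivWithinAt_Ici x (hs.trans hr.1))
    (hY.continuousOn_Icc y hs) (fun _ hr => hY.hasDerivWithinAt_Ici y (hs.trans hr.1))
    le_rfl t (right_mem_Icc.2 hst)

theorem norm_sub_euler_le (hY : IsForwardFlow V CV LV Y) (x : Euc d) {s t : ℝ} (hs : 0 ≤ s)
    (hst : s ≤ t) :
    ‖Y x t - (Y x s + (t - s) • V (Y x s) s)‖ ≤ LV * (CV + 1) * (t - s) ^ 2 := by
  have hbound : ∀ r ∈ Ico s t, ‖V (Y x r) r - V (Y x s) s‖ ≤ LV * ((CV + 1) * (t - s)) := by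
    intro r hr
    have h1 := hY.lipschitz.dist_le_mul (Y x r, r) (Y x s, s)
    rw [← dist_eq_norm]
    refine h1.trans ?_
    have h2 := hY.norm_sub_le x hs hr.1
    have h3 := hY.bound_nonneg
    have h4 : r - s ≤ t - s := by linarith [hr.2]
    have h5 : 0 ≤ r - s := sub_nonneg.2 hr.1
    gcongr
    rw [Prod.dist_eq, dist_eq_norm, Real.dist_eq, abs_of_nonneg h5]
    refine max_le ?_ ?_ <;> nlinarith
  have hderiv : ∀ r ∈ Ico s t, HasDerivWithinAt (fun r => Y x r - (r - s) • V (Y x s) s)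
      (V (Y x r) r - V (Y x s) s) (Ici r) r := by
    intro r hr
    have h := (((hasDerivWithinAt_id r (Ici r)).sub_const s).smul_const (V (Y x s) s))
    rw [one_smul] at h
    exact (hY.hasDerivWithinAt_Ici x (hs.trans hr.1)).sub h
  have hcont : ContinuousOn (fun r => Y x r - (r - s) • V (Y x s) s) (Icc s t) :=
    (hY.continuousOn_Icc x hs).sub (by fun_prop)
  have := norm_image_sub_le_of_norm_deriv_right_le_segment hcont hderiv hbound t
    (right_mem_Icc.2 hst)
  calc _ = ‖Y x t - (t - s) • V (Y x s) s - (Y x s - (s - s) • V (Y x s) s)‖ := by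
        congr 1
        simp only [sub_self, zero_smul]
        abel
    _ ≤ LV * ((CV + 1) * (t - s)) * (t - s) := this
    _ = _ := by ring

theorem norm_le_norm_add (hY : IsForwardFlow V CV LV Y) (x : Euc d) {s t T : ℝ} (hs : 0 ≤ s)
    (hst : s ≤ t) (htT : t - s ≤ T) : ‖Y x s‖ ≤ ‖Y x t‖ + CV * T := by
  have h1 := hY.norm_sub_le x hs hst
  have h2 : ‖Y x s‖ ≤ ‖Y x t‖ + ‖Y x t - Y x s‖ := norm_le_norm_add_norm_sub _ _
  have h3 := hY.bound_nonneg
  nlinarith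

/-- The flow of a divergence-free field preserves the integral of Lipschitz functions with
compact support. -/
theorem integral_comp_eq (hY : IsForwardFlow V CV LV Y) (hdiv : DivFree d V)
    (hXY : ∀ t : ℝ, 0 ≤ t → ∀ x, X (Y x t) t = x)
    (hYX : ∀ t : ℝ, 0 ≤ t → ∀ x, Y (X x t) t = x) {T : ℝ} (hT : 0 ≤ T)
    {ψ : Euc d → ℝ} {K : ℝ≥0} (hψ : LipschitzWith K ψ) (hψc : HasCompactSupport ψ) :
    ∫ x, ψ (Y x T) = ∫ x, ψ x := by
  have hC := hY.bound_nonneg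
  obtain ⟨R, hR⟩ : ∃ R : ℝ, ∀ x, R < ‖x‖ → ψ x = 0 := by
    obtain ⟨R, hR⟩ := hψc.isCompact.isBounded.subset_closedBall 0
    refine ⟨R, fun x hx => by_contra fun hne => ?_⟩
    have := hR (subset_tsupport _ hne)
    rw [mem_closedBall_zero_iff] at this
    linarith
  obtain ⟨M, hM⟩ : ∃ M : ℝ, ∀ x, |ψ x| ≤ M := hψc.exists_bound_of_continuous hψ.continuous
  have hM0 : 0 ≤ M := (abs_nonneg _).trans (hM 0)
  set w : ℝ → Euc d → ℝ := fun t x => ψ (Y (X x t) T) with hw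
  set K' : ℝ≥0 := K * (Real.exp (LV * T)).toNNReal with hK'
  have hwlip : ∀ t ∈ Icc 0 T, LipschitzWith K' (w t) := fun t ht => by
    refine LipschitzWith.of_dist_le_mul fun x y => ?_
    have h1 := hY.dist_le (X x t) (X y t) ht.1 ht.2
    rw [hYX t ht.1, hYX t ht.1] at h1
    have h2 : Real.exp (LV * (T - t)) ≤ Real.exp (LV * T) := by
      gcongr
      linarith [ht.1]
    calc dist (w t x) (w t y) ≤ K * dist (Y (X x t) T) (Y (X y t) T) := hψ.dist_le_mul _ _
      _ ≤ K * (dist x y * Real.exp (LV * T)) := by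
          gcongr
          exact h1.trans (by gcongr)
      _ = K' * dist x y := by
          rw [hK', NNReal.coe_mul, Real.coe_toNNReal _ (Real.exp_pos _).le]
          ring
  have hwsupp : ∀ t ∈ Icc 0 T, ∀ x, R + CV * T < ‖x‖ → w t x = 0 := fun t ht x hx => by
    refine hR _ ?_
    have := hY.norm_le_norm_add (X x t) (T := T) ht.1 ht.2 (by linarith [ht.1])
    rw [hYX t ht.1] at this
    linarith
  have hwc : ∀ t ∈ Icc 0 T, HasCompactSupport (w t) := fun t ht =>
    HasCompactSupport.intro (isCompact_closedBall 0 (R + CV * T)) fun x hx =>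
      hwsupp t ht x (by simpa using hx)
  have hwint : ∀ t ∈ Icc 0 T, Integrable (w t) := fun t ht =>
    (hwlip t ht).continuous.integrable_of_hasCompactSupport (hwc t ht)
  have hwflow : ∀ s ∈ Icc 0 T, ∀ t ∈ Icc 0 T, ∀ x, w s x = w t (Y (X x s) t) :=
    fun s _ t ht x => by simp only [hw, hXY t ht.1]
  set A : ℝ := volume.real (Metric.closedBall (0 : Euc d) (R + 2 * (CV * T))) with hA
  have hCT : 0 ≤ CV * T := by positivity
  have hlip : ∀ s ∈ Icc 0 T, ∀ t ∈ Icc 0 T, s ≤ t →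
      |(∫ x, w s x) - ∫ x, w t x| ≤ K' * (CV * (t - s)) * A := fun s hs t ht hst => by
    refine abs_integral_sub_integral_le (hwint s hs) (hwint t ht) (fun x => ?_) fun x hx =>
      ⟨hwsupp s hs x (by linarith), hwsupp t ht x (by linarith)⟩
    rw [hwflow s hs t ht, ← Real.dist_eq]
    refine ((hwlip t ht).dist_le_mul _ _).trans ?_
    gcongr
    have := hY.norm_sub_le (X x s) hs.1 hst
    rwa [hYX s hs.1, ← dist_eq_norm] at this
  have heuler : ∀ s ∈ Icc 0 T, ∀ t ∈ Icc 0 T, s ≤ t →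
      |(∫ x, w s x) - ∫ x, w t (x + (t - s) • V x s)| ≤
        K' * (LV * (CV + 1) * (t - s) ^ 2) * A := fun s hs t ht hst => by
    have hsupp : ∀ x, R + 2 * (CV * T) < ‖x‖ → w t (x + (t - s) • V x s) = 0 := fun x hx => by
      refine hwsupp t ht _ ?_
      have h1 : ‖(t - s) • V x s‖ ≤ CV * T := by
        rw [norm_smul, Real.norm_eq_abs, abs_of_nonneg (sub_nonneg.2 hst), mul_comm]
        have h2 := hY.norm_le x s
        have h3 : t - s ≤ T := by linarith [ht.2, hs.1]
        have h4 := sub_nonneg.2 hst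
        gcongr
      have h2 : ‖x‖ ≤ ‖x + (t - s) • V x s‖ + ‖(t - s) • V x s‖ := norm_le_add_norm_add _ _
      linarith
    have hcont : Continuous fun x => w t (x + (t - s) • V x s) :=
      (hwlip t ht).continuous.comp
        (continuous_id.add ((hY.lipschitz_slice s).continuous.const_smul (t - s)))
    refine abs_integral_sub_integral_le (hwint s hs)
      (hcont.integrable_of_hasCompactSupport (HasCompactSupport.intro
        (isCompact_closedBall 0 (R + 2 * (CV * T))) fun x hx => hsupp x (by simpa using hx)))
      (fun x => ?_) fun x hx => ⟨hwsupp s hs x (by linarith), hsupp x hx⟩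
    rw [hwflow s hs t ht, ← Real.dist_eq]
    refine ((hwlip t ht).dist_le_mul _ _).trans ?_
    gcongr
    have := hY.norm_sub_euler_le (X x s) hs.1 hst
    rwa [hYX s hs.1, ← dist_eq_norm] at this
  have habs : ∀ t ∈ Icc 0 T, ∫ x, |w t x| ≤ M * A := fun t ht => by
    have h := abs_integral_sub_integral_le (R := R + 2 * (CV * T)) (c := M) (hwint t ht).abs
      (integrable_zero _ _ _) (fun x => by simpa using hM _)
      fun x hx => ⟨by rw [hwsupp t ht x (by linarith), abs_zero], rfl⟩
    simp only [Pi.zero_apply, integral_zero, sub_zero] at h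
    exact (le_abs_self _).trans h
  have hA0 : 0 ≤ A := measureReal_nonneg
  have hderiv : ∀ t ∈ Ico 0 T, HasDerivWithinAt (fun s => ∫ x, w s x) 0 (Ici t) t := by
    intro s hs
    rw [hasDerivWithinAt_iff_isLittleO, Asymptotics.isLittleO_iff]
    intro c hc
    obtain ⟨δ, hδ, hstep⟩ := exists_abs_integral_euler_step_sub_le d LV
      (show 0 < c / (2 * (M * A + 1)) by positivity)
    set B : ℝ := K' * (LV * (CV + 1)) * A with hB
    have hB0 : 0 ≤ B := by positivity
    have hη : 0 < min (T - s) (min δ (c / (2 * (B + 1)))) := by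
      have := sub_pos.2 hs.2
      positivity
    filter_upwards [self_mem_nhdsWithin,
      mem_nhdsWithin_of_mem_nhds (Iio_mem_nhds (lt_add_of_pos_right s hη))] with t hst htη
    have hlt : t - s < min (T - s) (min δ (c / (2 * (B + 1)))) := by
      rw [mem_Iio] at htη
      linarith
    have ht : t ∈ Icc 0 T := ⟨hs.1.trans hst, by linarith [hlt.trans_le (min_le_left _ _)]⟩
    have hs' : s ∈ Icc 0 T := ⟨hs.1, hs.2.le⟩
    simp only [smul_zero, sub_zero, Real.norm_eq_abs]
    rcases (show s ≤ t from hst).eq_or_lt with rfl | hlt'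
    · simp
    have h0 : 0 < t - s := sub_pos.2 hlt'
    rw [abs_of_pos h0]
    have hδ' : t - s < δ := hlt.trans_le ((min_le_right _ _).trans (min_le_left _ _))
    have hBt : B * (t - s) ≤ c / 2 := by
      have : t - s < c / (2 * (B + 1)) :=
        hlt.trans_le ((min_le_right _ _).trans (min_le_right _ _))
      rw [lt_div_iff₀ (by positivity)] at this
      nlinarith
    have h1 := heuler s hs' t ht hst
    have h2 := hstep _ (hY.lipschitz_slice s) (hdiv s hs.1) (t - s) h0 hδ' (w t)
      (hwlip t ht).continuous (hwc t ht)
    have h3 : c / (2 * (M * A + 1)) * (t - s) * ∫ x, |w t x| ≤ c / 2 * (t - s) :=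
      calc _ ≤ c / (2 * (M * A + 1)) * (t - s) * (M * A + 1) := by
            gcongr
            linarith [habs t ht]
        _ = c / 2 * (t - s) := by field_simp
    calc |(∫ x, w t x) - ∫ x, w s x|
        ≤ |(∫ x, w t x) - ∫ x, w t (x + (t - s) • V x s)| +
          |(∫ x, w t (x + (t - s) • V x s)) - ∫ x, w s x| := abs_sub_le _ _ _
      _ ≤ c / 2 * (t - s) + B * (t - s) * (t - s) := by
          rw [abs_sub_comm]
          refine add_le_add (h2.trans h3) ?_
          rw [abs_sub_comm]
          exact h1.trans_eq (by rw [hB]; ring)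
      _ ≤ c / 2 * (t - s) + c / 2 * (t - s) := by gcongr
      _ = c * (t - s) := by ring
  have hcont : ContinuousOn (fun s => ∫ x, w s x) (Icc 0 T) := by
    refine (LipschitzOnWith.of_dist_le_mul (K := (K' * CV * A).toNNReal)
      fun s hs t ht => ?_).continuousOn
    rw [Real.coe_toNNReal _ (by positivity), Real.dist_eq, Real.dist_eq]
    rcases le_total s t with hst | hst
    · rw [abs_sub_comm s t, abs_of_nonneg (sub_nonneg.2 hst)]
      exact (hlip s hs t ht hst).trans_eq (by ring)
    · rw [abs_sub_comm, abs_of_nonneg (sub_nonneg.2 hst)]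
      exact (hlip t ht s hs hst).trans_eq (by ring)
  have hconst := constant_of_has_deriv_right_zero hcont hderiv T (right_mem_Icc.2 hT)
  have hX0 : ∀ x, X x 0 = x := fun x => by simpa [hY.zero] using hXY 0 le_rfl x
  simpa [hw, hYX T hT, hX0] using hconst.symm

theorem continuous_slice (hY : IsForwardFlow V CV LV Y) {T : ℝ} (hT : 0 ≤ T) :
    Continuous fun x => Y x T := by
  refine (LipschitzWith.of_dist_le_mul (K := (Real.exp (LV * T)).toNNReal)
    fun x y => ?_).continuous
  have := hY.dist_le x y le_rfl hT
  rw [hY.zero, hY.zero, sub_zero] at this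
  rw [Real.coe_toNNReal _ (Real.exp_pos _).le, mul_comm]
  exact this

theorem preimage_subset_closedBall (hY : IsForwardFlow V CV LV Y) {T R : ℝ} (hT : 0 ≤ T)
    {s : Set (Euc d)} (hs : s ⊆ Metric.closedBall 0 R) :
    (fun x => Y x T) ⁻¹' s ⊆ Metric.closedBall 0 (R + CV * T) := fun x hx => by
  have h1 := hY.norm_le_norm_add x le_rfl hT (T := T) (by simp)
  have h2 : ‖Y x T‖ ≤ R := by simpa using hs hx
  rw [hY.zero] at h1
  rw [mem_closedBall_zero_iff]
  linarith

end IsForwardFlow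

/-- Locally finite measures on `ℝ^d` are determined by the integrals of Lipschitz functions with
compact support. -/
theorem ext_of_integral_lipschitz_eq {d : ℕ} (hd : 1 ≤ d) {μ ν : Measure (Euc d)}
    [IsFiniteMeasureOnCompacts μ] [IsFiniteMeasureOnCompacts ν]
    (h : ∀ (K : ℝ≥0) (ψ : Euc d → ℝ), LipschitzWith K ψ → HasCompactSupport ψ →
      ∫ x, ψ x ∂μ = ∫ x, ψ x ∂ν) : μ = ν := by
  have : Nonempty (Fin d) := ⟨⟨0, hd⟩⟩
  refine Measure.OuterRegular.ext_isOpen_isBounded fun U hU hUb => ?_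
  have hne : Uᶜ.Nonempty := by
    rw [nonempty_compl]
    rintro rfl
    exact NormedSpace.unbounded_univ ℝ (Euc d) hUb
  set g : ℕ → Euc d → ℝ := fun n x => min 1 (n * Metric.infDist x Uᶜ) with hg
  have hlip : ∀ n : ℕ, LipschitzWith n (g n) := fun n => by
    have h1 : LipschitzWith (n : ℝ≥0) fun x => (n : ℝ) * Metric.infDist x Uᶜ := by
      refine LipschitzWith.of_dist_le_mul fun x y => ?_
      have := (Metric.lipschitz_infDist_pt Uᶜ).dist_le_mul x y
      rw [Real.dist_eq, ← mul_sub, abs_mul, Nat.abs_cast, NNReal.coe_natCast]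
      gcongr
      simpa [Real.dist_eq] using this
    exact h1.const_min 1
  have hzero : ∀ n, ∀ x ∉ U, g n x = 0 := fun n x hx => by
    simp [hg, Metric.infDist_zero_of_mem (show x ∈ Uᶜ from hx)]
  have hcomp : ∀ n, HasCompactSupport (g n) := fun n =>
    HasCompactSupport.intro (hUb.isCompact_closure) fun x hx =>
      hzero n x fun hxU => hx (subset_closure hxU)
  have hlim : ∀ x, Tendsto (fun n => g n x) atTop (𝓝 (U.indicator 1 x)) := fun x => by
    by_cases hx : x ∈ U
    · have hpos : 0 < Metric.infDist x Uᶜ :=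
        (hU.isClosed_compl.notMem_iff_infDist_pos hne).1 (by simpa using hx)
      have h1 : ∀ᶠ n : ℕ in atTop, 1 ≤ (n : ℝ) * Metric.infDist x Uᶜ :=
        (tendsto_natCast_atTop_atTop.atTop_mul_const hpos).eventually_ge_atTop 1
      refine tendsto_const_nhds.congr' ?_
      filter_upwards [h1] with n hn
      simp [hg, hx, hn]
    · simp [hzero _ x hx, hx]
  have key : ∀ (ρ : Measure (Euc d)) [IsFiniteMeasureOnCompacts ρ],
      ρ U < ∞ ∧ Tendsto (fun n => ∫ x, g n x ∂ρ) atTop (𝓝 (ρ.real U)) := fun ρ _ => by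
    have hfin : ρ U < ∞ := hUb.measure_lt_top
    refine ⟨hfin, ?_⟩
    rw [← integral_indicator_one hU.measurableSet]
    refine tendsto_integral_of_dominated_convergence (U.indicator 1)
      (fun n => (hlip n).continuous.aestronglyMeasurable)
      ((integrable_indicator_iff hU.measurableSet).2 (integrableOn_const hfin.ne))
      (fun n => Eventually.of_forall fun x => ?_) (Eventually.of_forall hlim)
    by_cases hx : x ∈ U
    · have : 0 ≤ (n : ℝ) * Metric.infDist x Uᶜ :=
        mul_nonneg n.cast_nonneg Metric.infDist_nonneg
      rw [Real.norm_eq_abs, abs_of_nonneg (le_min zero_le_one this)]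
      simp [hx]
    · simp [hzero n x hx, hx]
  obtain ⟨hμ, hμlim⟩ := key μ
  obtain ⟨hν, hνlim⟩ := key ν
  have heq := tendsto_nhds_unique hμlim (hνlim.congr fun n => (h _ _ (hlip n) (hcomp n)).symm)
  exact (ENNReal.toReal_eq_toReal_iff' hμ.ne hν.ne).1 heq

namespace IsForwardFlow

variable {d : ℕ} {V : Euc d → ℝ → Euc d} {CV : ℝ} {LV : ℝ≥0} {Y X : Euc d → ℝ → Euc d}

/-- **Liouville's theorem**: the flow of a divergence-free field preserves the volume. -/
theorem measurePreserving (hY : IsForwardFlow V CV LV Y) (hd : 1 ≤ d) (hdiv : DivFree d V)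
    (hXY : ∀ t : ℝ, 0 ≤ t → ∀ x, X (Y x t) t = x)
    (hYX : ∀ t : ℝ, 0 ≤ t → ∀ x, Y (X x t) t = x) {T : ℝ} (hT : 0 ≤ T) :
    MeasurePreserving (fun x => Y x T) := by
  have hcont := hY.continuous_slice hT
  refine ⟨hcont.measurable, ?_⟩
  have : IsFiniteMeasureOnCompacts (volume.map fun x => Y x T) := ⟨fun k hk => by
    rw [Measure.map_apply hcont.measurable hk.measurableSet]
    obtain ⟨R, hR⟩ := hk.isBounded.subset_closedBall 0
    exact (measure_mono (hY.preimage_subset_closedBall hT hR)).trans_lt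
      measure_closedBall_lt_top⟩
  refine ext_of_integral_lipschitz_eq hd fun K ψ hψ hψc => ?_
  rw [integral_map hcont.aemeasurable hψ.continuous.aestronglyMeasurable]
  exact hY.integral_comp_eq hdiv hXY hYX hT hψ hψc

theorem continuous_extend (hY : IsForwardFlow V CV LV Y) :
    Continuous fun p : Euc d × ℝ => Y p.1 (max p.2 0) := by
  refine continuous_iff_continuousAt.2 fun q => ?_
  refine tendsto_iff_dist_tendsto_zero.2 (squeeze_zero
    (g := fun p : Euc d × ℝ => dist p.1 q.1 * Real.exp (LV * max p.2 0) +
      CV * |max p.2 0 - max q.2 0|) (fun _ => dist_nonneg) (fun p => ?_) ?_)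
  · refine (dist_triangle _ (Y q.1 (max p.2 0)) _).trans (add_le_add ?_ ?_)
    · simpa [hY.zero] using hY.dist_le p.1 q.1 le_rfl (le_max_right p.2 0)
    · rw [dist_eq_norm]
      rcases le_total (max q.2 0) (max p.2 0) with h | h
      · rw [abs_of_nonneg (sub_nonneg.2 h)]
        exact hY.norm_sub_le q.1 (le_max_right _ _) h
      · rw [norm_sub_rev, abs_sub_comm, abs_of_nonneg (sub_nonneg.2 h)]
        exact hY.norm_sub_le q.1 (le_max_right _ _) h
  · have : Continuous fun p : Euc d × ℝ => dist p.1 q.1 * Real.exp (LV * max p.2 0) +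
        CV * |max p.2 0 - max q.2 0| := by fun_prop
    simpa using this.tendsto q

/-- The space-time flow map, frozen in space for negative times. -/
def spaceTime (Y : Euc d → ℝ → Euc d) (p : Euc d × ℝ) : Euc d × ℝ := (Y p.1 (max p.2 0), p.2)

theorem continuous_spaceTime (hY : IsForwardFlow V CV LV Y) : Continuous (spaceTime Y) :=
  hY.continuous_extend.prodMk continuous_snd

theorem measurableEmbedding_spaceTime (hY : IsForwardFlow V CV LV Y)
    (hXY : ∀ t : ℝ, 0 ≤ t → ∀ x, X (Y x t) t = x) : MeasurableEmbedding (spaceTime Y) := by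
  refine hY.continuous_spaceTime.measurableEmbedding fun p q h => ?_
  obtain ⟨h1, h2⟩ := Prod.ext_iff.1 h
  simp only [spaceTime] at h1 h2
  rw [← h2] at h1
  refine Prod.ext ?_ h2
  rw [← hXY _ (le_max_right p.2 0) p.1, h1, hXY _ (le_max_right p.2 0)]

theorem measurePreserving_spaceTime (hY : IsForwardFlow V CV LV Y) (hd : 1 ≤ d)
    (hdiv : DivFree d V) (hXY : ∀ t : ℝ, 0 ≤ t → ∀ x, X (Y x t) t = x)
    (hYX : ∀ t : ℝ, 0 ≤ t → ∀ x, Y (X x t) t = x) : MeasurePreserving (spaceTime Y) := by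
  have h : MeasurePreserving (fun q : ℝ × Euc d => (id q.1, Y q.2 (max q.1 0)))
      (volume.prod volume) (volume.prod volume) :=
    (MeasurePreserving.id volume).skew_product
      (g := fun (t : ℝ) (x : Euc d) => Y x (max t 0))
      (hY.continuous_extend.comp continuous_swap).measurable
      (Eventually.of_forall fun t => (hY.measurePreserving hd hdiv hXY hYX (le_max_right t 0)).map_eq)
  exact measurePreserving_swap.comp (h.comp measurePreserving_swap)

theorem preimage_spaceTime_closedBall_subset (hY : IsForwardFlow V CV LV Y) {R : ℝ}
    (hR : 0 ≤ R) : spaceTime Y ⁻¹' Metric.closedBall 0 R ⊆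
      Metric.closedBall 0 (R + CV * R) ×ˢ Metric.closedBall 0 R := fun p hp => by
  rw [mem_preimage, mem_closedBall_zero_iff, spaceTime, norm_prod_le_iff] at hp
  have h1 : max p.2 0 ≤ R := max_le ((le_abs_self _).trans hp.2) hR
  have h2 := hY.norm_le_norm_add p.1 le_rfl (le_max_right p.2 0) (T := R) (by simpa using h1)
  rw [hY.zero] at h2
  rw [mem_prod, mem_closedBall_zero_iff, mem_closedBall_zero_iff]
  exact ⟨by linarith [hp.1], hp.2⟩

end IsForwardFlow

theorem MeasureTheory.LocallyIntegrable.integrableOn_comp_fst {d : ℕ} {f : Euc d → ℝ}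
    (hf : LocallyIntegrable f) (R S : ℝ) :
    IntegrableOn (fun p : Euc d × ℝ => f p.1)
      (Metric.closedBall 0 R ×ˢ Metric.closedBall 0 S) := by
  have : IsFiniteMeasure (volume.restrict (Metric.closedBall (0 : ℝ) S)) :=
    
    ⟨by rw [Measure.restrict_apply_univ]; exact measure_closedBall_lt_top⟩
  rw [IntegrableOn, Measure.volume_eq_prod, ← Measure.prod_restrict]
  exact Integrable.comp_fst (hf.integrableOn_isCompact (isCompact_closedBall 0 R)) _

namespace IsForwardFlow

variable {d : ℕ} {V : Euc d → ℝ → Euc d} {CV : ℝ} {LV : ℝ≥0} {Y X : Euc d → ℝ → Euc d}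

theorem locallyIntegrableOn_comp_inverse (hY : IsForwardFlow V CV LV Y) (hd : 1 ≤ d)
    (hdiv : DivFree d V) (hXY : ∀ t : ℝ, 0 ≤ t → ∀ x, X (Y x t) t = x)
    (hYX : ∀ t : ℝ, 0 ≤ t → ∀ x, Y (X x t) t = x) {u0 : Euc d → ℝ}
    (hu0 : LocallyIntegrable u0) :
    LocallyIntegrableOn (fun p : Euc d × ℝ => u0 (X p.1 p.2)) {p | 0 ≤ p.2} := by
  intro p _
  have hint : IntegrableOn (fun q : Euc d × ℝ => u0 (X q.1 (max q.2 0)))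
      (Metric.closedBall 0 (‖p‖ + 1)) := by
    rw [← (hY.measurePreserving_spaceTime hd hdiv hXY hYX).integrableOn_comp_preimage
      (hY.measurableEmbedding_spaceTime hXY)]
    have h : (fun q : Euc d × ℝ => u0 (X q.1 (max q.2 0))) ∘ spaceTime Y = fun q => u0 q.1 := by
      funext q
      simp [spaceTime, hXY _ (le_max_right q.2 0)]
    rw [h]
    exact (hu0.integrableOn_comp_fst _ _).mono_set
      (hY.preimage_spaceTime_closedBall_subset (by positivity))
  have hs : MeasurableSet {q : Euc d × ℝ | 0 ≤ q.2} :=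
    measurableSet_le measurable_const measurable_snd
  refine ⟨{q | 0 ≤ q.2} ∩ Metric.closedBall 0 (‖p‖ + 1), inter_mem_nhdsWithin _ ?_, ?_⟩
  · exact mem_of_superset (Metric.ball_mem_nhds p one_pos) fun q hq => by
      rw [mem_ball_iff_norm] at hq
      rw [mem_closedBall_zero_iff]
      linarith [norm_sub_norm_le q p]
  · refine (hint.mono_set inter_subset_right).congr_fun (fun q hq => ?_)
      (hs.inter measurableSet_closedBall)
    simp only [max_eq_left (show 0 ≤ q.2 from hq.1)]

/-- A test function and the field enter the weak formulation through the derivative of the test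
function along the characteristics. -/
theorem weak_formulation (hY : IsForwardFlow V CV LV Y) (hd : 1 ≤ d)
    (hdiv : DivFree d V) (hXY : ∀ t : ℝ, 0 ≤ t → ∀ x, X (Y x t) t = x)
    (hYX : ∀ t : ℝ, 0 ≤ t → ∀ x, Y (X x t) t = x) {u0 : Euc d → ℝ}
    (hu0 : LocallyIntegrable u0) {φ : Euc d × ℝ → ℝ} (hφ : ContDiff ℝ (⊤ : ℕ∞) φ)
    (hφc : HasCompactSupport φ) :
    (∫ t in Ioi (0 : ℝ), ∫ x : Euc d,
        u0 (X x t) * (fderiv ℝ φ (x, t) (0, 1) + fderiv ℝ φ (x, t) (V x t, 0)))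
      + ∫ x : Euc d, u0 x * φ (x, 0) = 0 := by
  obtain ⟨R, hR0, hR⟩ : ∃ R : ℝ, 0 ≤ R ∧ tsupport φ ⊆ Metric.closedBall 0 R := by
    obtain ⟨R, hR⟩ := hφc.isCompact.isBounded.subset_closedBall 0
    exact ⟨max R 0, le_max_right _ _, hR.trans (Metric.closedBall_subset_closedBall
      (le_max_left _ _))⟩
  set g : Euc d × ℝ → ℝ := fun p => fderiv ℝ φ (spaceTime Y p) (V (spaceTime Y p).1 p.2, 1)
    with hg
  have hgcont : Continuous g :=
    ((hφ.continuous_fderiv (by simp)).comp hY.continuous_spaceTime).clm_apply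
      ((hY.lipschitz.continuous.comp hY.continuous_spaceTime).prodMk continuous_const)
  set S : Set (Euc d × ℝ) := Metric.closedBall 0 (R + CV * R) ×ˢ Metric.closedBall 0 R with hS
  have hgS : ∀ p ∉ S, g p = 0 := fun p hp => by
    have h : fderiv ℝ φ (spaceTime Y p) = 0 := by
      by_contra hne
      exact hp (hY.preimage_spaceTime_closedBall_subset hR0
        (hR (support_fderiv_subset ℝ hne)))
    simp [hg, h]
  have hgc : HasCompactSupport g :=
    HasCompactSupport.intro ((isCompact_closedBall 0 _).prod (isCompact_closedBall 0 _)) hgS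
  obtain ⟨M, hM⟩ := hgc.exists_bound_of_continuous hgcont
  have hint : Integrable (fun p : Euc d × ℝ => u0 p.1 * g p) (volume.prod volume) := by
    rw [← Measure.volume_eq_prod, ← integrableOn_iff_integrable_of_support_subset (s := S)]
    · exact (hu0.integrableOn_comp_fst _ _).mul_bdd hgcont.aestronglyMeasurable
        (Eventually.of_forall hM)
    · intro p hp
      by_contra hpS
      exact hp (by simp [hgS p hpS])
  have hint' : Integrable (Function.uncurry fun (t : ℝ) (x : Euc d) => u0 x * g (x, t))
      ((volume.restrict (Ioi 0)).prod volume) := by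
    have h := hint.swap.integrableOn (s := Ioi 0 ×ˢ univ)
    rwa [IntegrableOn, ← Measure.prod_restrict, Measure.restrict_univ] at h
  have hinner : ∀ t ∈ Ioi (0 : ℝ), ∫ x : Euc d,
      u0 (X x t) * (fderiv ℝ φ (x, t) (0, 1) + fderiv ℝ φ (x, t) (V x t, 0)) =
        ∫ x, u0 x * g (x, t) := fun t ht => by
    have ht0 : 0 ≤ t := le_of_lt ht
    have hemb : MeasurableEmbedding fun x => Y x t :=
      (hY.continuous_slice ht0).measurableEmbedding
        (Function.LeftInverse.injective (g := fun x => X x t) (hXY t ht0))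
    rw [← (hY.measurePreserving hd hdiv hXY hYX ht0).integral_comp hemb]
    refine integral_congr_ae (Eventually.of_forall fun x => ?_)
    simp only [hXY t ht0, hg, spaceTime, max_eq_left ht0, ← map_add, Prod.mk_add_mk, zero_add,
      add_zero]
  have htime : ∀ x, ∫ t in Ioi (0 : ℝ), g (x, t) = - φ (x, 0) := fun x => by
    have hcont : Continuous fun t : ℝ => φ (spaceTime Y (x, t)) :=
      hφ.continuous.comp (hY.continuous_spaceTime.comp (by fun_prop))
    have hderiv : ∀ t ∈ Ioi (0 : ℝ),
        HasDerivAt (fun t : ℝ => φ (spaceTime Y (x, t))) (g (x, t)) t := fun t ht => by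
      have h1 : HasDerivAt (Y x) (V (Y x t) t) t :=
        (hY.deriv x t (le_of_lt ht)).hasDerivAt (Ici_mem_nhds ht)
      have h2 : HasDerivAt (fun t => Y x (max t 0)) (V (Y x t) t) t := by
        refine h1.congr_of_eventuallyEq ?_
        filter_upwards [Ioi_mem_nhds ht] with s hs
        rw [max_eq_left (le_of_lt hs)]
      have h3 : HasDerivAt (fun t => spaceTime Y (x, t)) (V (Y x t) t, 1) t :=
        h2.prodMk (hasDerivAt_id t)
      have hf : HasFDerivAt φ (fderiv ℝ φ (spaceTime Y (x, t))) (spaceTime Y (x, t)) :=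
        (hφ.differentiable (by simp) _).hasFDerivAt
      have h4 := HasFDerivAt.comp_hasDerivAt (f := fun t => spaceTime Y (x, t)) t hf h3
      have h5 : (spaceTime Y (x, t)).1 = Y x t := by
        simp only [spaceTime, max_eq_left (le_of_lt (show 0 < t from ht))]
      simp only [hg, h5]
      exact h4
    have hslice : Integrable fun t => g (x, t) := by
      refine (hgcont.comp (Continuous.prodMk_right x)).integrable_of_hasCompactSupport
        (HasCompactSupport.intro (isCompact_closedBall 0 R) fun t ht => hgS _ fun h => ht h.2)
    have hlim : Tendsto (fun t : ℝ => φ (spaceTime Y (x, t))) atTop (𝓝 0) := by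
      refine tendsto_const_nhds.congr' ?_
      filter_upwards [eventually_gt_atTop R] with t ht
      refine (image_eq_zero_of_notMem_tsupport fun h => ?_).symm
      have h1 := hR h
      rw [mem_closedBall_zero_iff, norm_prod_le_iff] at h1
      exact absurd ((le_abs_self t).trans h1.2) (not_le.2 ht)
    rw [integral_Ioi_of_hasDerivAt_of_tendsto hcont.continuousWithinAt hderiv
      hslice.integrableOn hlim]
    simp [spaceTime, hY.zero]
  rw [setIntegral_congr_fun measurableSet_Ioi hinner, integral_integral_swap hint']
  simp only [integral_const_mul, htime, mul_neg, integral_neg, neg_add_cancel]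

end IsForwardFlow

/-- **Existence via characteristics**: for every `u0 ∈ L¹_loc(ℝ^d)`, the function
`u(x,t) := u0(X(x,t))`, where `X(·,t)` is the inverse of the flow `Y(·,t)` of the
bounded Lipschitz divergence-free field `V`, is a weak solution of the linear
advection problem with initial datum `u0`. -/
theorem characteristics_give_weak_solution (d : ℕ) (hd : 1 ≤ d)
    (V : Euc d → ℝ → Euc d) (CV : ℝ) (LV : ℝ≥0)
    (hVbdd : ∀ x t, ‖V x t‖ ≤ CV)
    (hVlip : LipschitzWith LV (fun p : Euc d × ℝ => V p.1 p.2))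
    (hVdiv : DivFree d V)
    (Y X : Euc d → ℝ → Euc d)
    (hY0 : ∀ x, Y x 0 = x)
    (hYderiv : ∀ x, ∀ t : ℝ, 0 ≤ t → HasDerivWithinAt (Y x) (V (Y x t) t) (Ici 0) t)
    (hXY : ∀ t : ℝ, 0 ≤ t → ∀ x, X (Y x t) t = x)
    (hYX : ∀ t : ℝ, 0 ≤ t → ∀ x, Y (X x t) t = x)
    (u0 : Euc d → ℝ) (hu0 : LocallyIntegrable u0) :
    IsWeakSol d V u0 (fun x t => u0 (X x t)) := by
  have hY : IsForwardFlow V CV LV Y := ⟨hVbdd, hVlip, hY0, hYderiv⟩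
  exact ⟨hY.locallyIntegrableOn_comp_inverse hd hVdiv hXY hYX hu0,
    fun _ hφ hφc => hY.weak_formulation hd hVdiv hXY hYX hu0 hφ hφc⟩
end
end

section
/- Let f : ℝ → ℝ be measurable and u0 ∈ L^1_loc(ℝ^d) be such that f ∘ u0 ∈ L^1(ℝ^d). Then for the solution u(x,t) := u0(X(x,t)), the quantity ∫_{ℝ^d} f(u(x,t)) dx is independent of t ≥ 0, and equals ∫_{ℝ^d} f(u0(x)) dx. -/
open MeasureTheory Measure Set
open scoped ENNReal NNReal InnerProductSpace Topology

noncomputable section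

/-- The determinant on endomorphisms has derivative `trace` at the identity. -/
theorem hasFDerivAt_det_one_add {E : Type*} [NormedAddCommGroup E] [NormedSpace ℝ E]
    [FiniteDimensional ℝ E] :
    HasFDerivAt (fun A : E →L[ℝ] E => (1 + A).det)
      (LinearMap.toContinuousLinearMap
        ((LinearMap.trace ℝ E) ∘ₗ (ContinuousLinearMap.coeLM ℝ))) 0 := by
  let b := Module.finBasis ℝ E
  let m : (E →L[ℝ] E) →ₗ[ℝ] Matrix _ _ ℝ :=
    (LinearMap.toMatrix b b).toLinearMap ∘ₗ (ContinuousLinearMap.coeLM ℝ)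
  have hm : ∀ A : E →L[ℝ] E, (1 + A).det = (1 + m A).det := by
    intro A
    rw [ContinuousLinearMap.det, ← LinearMap.det_toMatrix b]
    simp [m, map_add]
  have hdiff : DifferentiableAt ℝ (fun A : E →L[ℝ] E => (1 + A).det) 0 := by
    simp_rw [hm, Matrix.det_apply]
    have hent : ∀ i j, Differentiable ℝ fun A : E →L[ℝ] E => m A i j := fun i j =>
      (LinearMap.toContinuousLinearMap
        ((Matrix.entryLinearMap ℝ ℝ i j) ∘ₗ m)).differentiable
    simp only [Matrix.add_apply]
    fun_prop
  convert hdiff.hasFDerivAt using 1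
  ext A
  have h1 : HasDerivAt (fun r : ℝ => (1 + r • A).det) (LinearMap.trace ℝ E (A : E →ₗ[ℝ] E)) 0 := by
    simp only [hm, map_smul]
    rw [funext fun r => Matrix.det_one_add_smul r (m A)]
    have htr : (m A).trace = LinearMap.trace ℝ E (A : E →ₗ[ℝ] E) := by
      simp [m, LinearMap.trace_eq_matrix_trace ℝ b]
    rw [htr]
    generalize Polynomial.divX (R := ℝ) (Polynomial.divX _) = p
    have := (((hasDerivAt_id (0 : ℝ)).const_mul (LinearMap.trace ℝ E (A : E →ₗ[ℝ] E))).const_add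
      1).add ((p.hasDerivAt 0).mul ((hasDerivAt_id (0 : ℝ)).pow 2))
    simpa using! this
  have h2 : HasDerivAt (fun r : ℝ => r • A) A 0 := by
    simpa using (hasDerivAt_id (0 : ℝ)).smul_const A
  have h3 := HasFDerivAt.comp_hasDerivAt_of_eq (0 : ℝ) hdiff.hasFDerivAt h2 (by simp)
  exact h1.unique h3

theorem exists_abs_det_one_add_smul_sub_one_le {E : Type*} [NormedAddCommGroup E]
    [NormedSpace ℝ E] [FiniteDimensional ℝ E] (L : ℝ) {ε : ℝ} (hε : 0 < ε) :
    ∃ h₀ > 0, ∀ h : ℝ, 0 ≤ h → h ≤ h₀ → ∀ A : E →L[ℝ] E, ‖A‖ ≤ L →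
      LinearMap.trace ℝ E (A : E →ₗ[ℝ] E) = 0 → |(1 + h • A).det - 1| ≤ ε * h := by
  have hc : 0 < ε / (|L| + 1) := by positivity
  have := (hasFDerivAt_det_one_add (E := E)).isLittleO.def hc
  obtain ⟨r, hr, hball⟩ := Metric.eventually_nhds_iff_ball.1 this
  refine ⟨r / (|L| + 2), by positivity, fun h h0 hh A hA htr => ?_⟩
  have hhA : ‖h • A‖ ≤ h * (|L| + 1) := by
    rw [norm_smul, Real.norm_of_nonneg h0]
    gcongr
    linarith [le_abs_self L]
  have hlt : h * (|L| + 1) < r := by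
    rw [le_div_iff₀ (by positivity)] at hh
    rcases h0.eq_or_lt with rfl | h0
    · simpa using hr
    · nlinarith
  have := hball (h • A) (by rw [mem_ball_zero_iff]; exact hhA.trans_lt hlt)
  have h1 : (1 : E →L[ℝ] E).det = 1 := by simp [ContinuousLinearMap.det]
  simp only [add_zero, sub_zero, h1, map_smul, Real.norm_eq_abs] at this
  have h2 : (LinearMap.toContinuousLinearMap
        ((LinearMap.trace ℝ E) ∘ₗ (ContinuousLinearMap.coeLM ℝ))) A = 0 := htr
  rw [h2, smul_zero, sub_zero] at this
  calc _ ≤ _ := this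
    _ ≤ ε / (|L| + 1) * (h * (|L| + 1)) := by gcongr
    _ = ε * h := by field_simp

/-- A Lipschitz vector field which is divergence-free in the sense of distributions is
divergence-free almost everywhere. -/
theorem ae_trace_fderiv_eq_zero {d : ℕ} {W : Euc d → Euc d} {L : ℝ≥0} (hW : LipschitzWith L W)
    (hdiv : ∀ ψ : Euc d → ℝ, ContDiff ℝ (⊤ : ℕ∞) ψ → HasCompactSupport ψ →
      ∫ x : Euc d, fderiv ℝ ψ x (W x) = 0) :
    ∀ᵐ x, LinearMap.trace ℝ (Euc d) (fderiv ℝ W x : Euc d →ₗ[ℝ] Euc d) = 0 := by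
  let b := EuclideanSpace.basisFun (Fin d) ℝ
  have hproj : ∀ i, LipschitzWith L fun x => W x i := fun i =>
    LipschitzWith.of_dist_le_mul fun x y => by
      refine le_trans ?_ (hW.dist_le_mul x y)
      rw [dist_eq_norm, dist_eq_norm]
      exact PiLp.norm_apply_le (W x - W y) i
  have hloc : LocallyIntegrable (fun x => ∑ i, lineDeriv ℝ (fun x => W x i) x (b i)) :=
    locallyIntegrable_finsetSum _ fun i _ => (hproj i).locallyIntegrable_lineDeriv (b i)
  have hzero := ae_eq_zero_of_integral_contDiff_smul_eq_zero hloc (by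
    intro ψ hψ hψc
    obtain ⟨D, hD⟩ := (hψ.of_le (by simp)).lipschitzWith_of_hasCompactSupport hψc one_ne_zero
    have hint : ∀ i, Integrable fun x => lineDeriv ℝ (fun x => W x i) x (b i) * ψ x := by
      intro i
      simpa [mul_comm] using ((hproj i).locallyIntegrable_lineDeriv
        (b i)).integrable_smul_left_of_hasCompactSupport hψ.continuous hψc
    have hint' : ∀ i, Integrable fun x => lineDeriv ℝ ψ x (-(b i)) * W x i := by
      intro i
      have hl : ∀ x, lineDeriv ℝ ψ x (-(b i)) = fderiv ℝ ψ x (-(b i)) := fun x =>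
        ((hψ.differentiable (by simp)) x).lineDeriv_eq_fderiv
      simp_rw [hl]
      refine Continuous.integrable_of_hasCompactSupport ?_ ?_
      · exact ((hψ.continuous_fderiv (by simp)).clm_apply continuous_const).mul (hproj i).continuous
      · exact (hψc.fderiv_apply ℝ (-(b i))).mul_right
    simp_rw [smul_eq_mul, Finset.mul_sum, mul_comm (ψ _)]
    rw [integral_finsetSum _ fun i _ => hint i]
    simp_rw [(hproj _).integral_lineDeriv_mul_eq hD hψc]
    rw [← integral_finsetSum _ fun i _ => hint' i]
    rw [← neg_zero, ← hdiv ψ hψ hψc, ← integral_neg]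
    congr 1
    ext x
    have hx := (b.sum_repr (W x))
    conv_rhs => rw [← hx]
    simp_rw [_root_.map_sum, map_smul, ((hψ.differentiable (by simp)) x).lineDeriv_eq_fderiv, map_neg]
    simp [b, mul_comm])
  filter_upwards [hzero, hW.ae_differentiableAt] with x hx hdx
  rw [LinearMap.trace_eq_sum_inner _ b, ← hx]
  refine Finset.sum_congr rfl fun i _ => ?_
  have h2 : HasFDerivAt (fun x => W x i) ((EuclideanSpace.proj i).comp (fderiv ℝ W x)) x :=
    (EuclideanSpace.proj (𝕜 := ℝ) i).hasFDerivAt.comp x hdx.hasFDerivAt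
  rw [h2.differentiableAt.lineDeriv_eq_fderiv, h2.fderiv]
  simp [b, EuclideanSpace.inner_single_left]

/-- A bijective Lipschitz map whose Jacobian is almost everywhere between `K⁻¹`
and `K` distorts volumes of preimages by at most a factor `K`. -/
theorem volume_preimage_le_and_le_of_abs_det {d : ℕ} {T : Euc d → Euc d} {C : ℝ≥0}
    (hT : LipschitzWith C T) (hbij : Function.Bijective T) {K : ℝ} (hK : 0 < K)
    (hdet : ∀ᵐ x, |(fderiv ℝ T x).det| ≤ K ∧ K⁻¹ ≤ |(fderiv ℝ T x).det|)
    {A : Set (Euc d)} (hA : MeasurableSet A) :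
    volume (T ⁻¹' A) ≤ ENNReal.ofReal K * volume A ∧
      volume A ≤ ENNReal.ofReal K * volume (T ⁻¹' A) := by
  let G : Set (Euc d) := {x | DifferentiableAt ℝ T x}
  have hG : MeasurableSet G := measurableSet_of_differentiableAt ℝ T
  have hGc : volume Gᶜ = 0 := hT.ae_differentiableAt
  have hnull : volume (T '' Gᶜ) = 0 := by
    let μ : Measure (Euc d) := μH[Module.finrank ℝ (Euc d)]
    have h1 : μ Gᶜ = 0 := (isAddLeftInvariant_eq_smul μ volume ▸ by simp [hGc])
    have h2 : μ (T '' Gᶜ) = 0 := by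
      refine le_antisymm ((hT.hausdorffMeasure_image_le (by positivity) _).trans ?_) zero_le
      rw [show μH[Module.finrank ℝ (Euc d)] Gᶜ = 0 from h1, mul_zero]
    have h3 := isAddLeftInvariant_eq_smul (volume : Measure (Euc d)) μ
    rw [h3]
    simp [h2]
  set S := T ⁻¹' A ∩ G with hS
  have hSm : MeasurableSet S := (hT.continuous.measurable hA).inter hG
  have hvS : volume (T ⁻¹' A) = volume S := (measure_inter_conull hGc).symm
  have hvA : volume A = volume (T '' S) := by
    have h1 : A = T '' S ∪ T '' (T ⁻¹' A ∩ Gᶜ) := by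
      rw [← image_union, ← inter_union_distrib_left, union_compl_self, inter_univ,
        image_preimage_eq _ hbij.2]
    refine le_antisymm ?_ (measure_mono (h1 ▸ subset_union_left))
    calc volume A = volume (T '' S ∪ T '' (T ⁻¹' A ∩ Gᶜ)) := by rw [← h1]
      _ ≤ volume (T '' S) + volume (T '' (T ⁻¹' A ∩ Gᶜ)) := measure_union_le _ _
      _ = volume (T '' S) := by
        rw [measure_mono_null (image_mono inter_subset_right) hnull, add_zero]
  have hint : ∫⁻ x in S, ENNReal.ofReal |(fderiv ℝ T x).det| = volume (T '' S) :=
    lintegral_abs_det_fderiv_eq_addHaar_image volume hSm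
      (fun x hx => (show DifferentiableAt ℝ T x from hx.2).hasFDerivAt.hasFDerivWithinAt)
      hbij.1.injOn
  have hle : volume (T '' S) ≤ ENNReal.ofReal K * volume S := by
    rw [← hint, ← setLIntegral_const]
    refine lintegral_mono_ae (ae_restrict_of_ae ?_)
    filter_upwards [hdet] with x hx using ENNReal.ofReal_le_ofReal hx.1
  have hge : ENNReal.ofReal K⁻¹ * volume S ≤ volume (T '' S) := by
    rw [← hint, ← setLIntegral_const]
    refine lintegral_mono_ae (ae_restrict_of_ae ?_)
    filter_upwards [hdet] with x hx using ENNReal.ofReal_le_ofReal hx.2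
  rw [hvS, hvA]
  refine ⟨?_, hle⟩
  calc volume S = ENNReal.ofReal K * (ENNReal.ofReal K⁻¹ * volume S) := by
        rw [← mul_assoc, ← ENNReal.ofReal_mul hK.le, mul_inv_cancel₀ hK.ne', ENNReal.ofReal_one,
          one_mul]
    _ ≤ _ := by gcongr

theorem bijective_id_add_of_lipschitzWith {E : Type*} [NormedAddCommGroup E] [NormedSpace ℝ E]
    [CompleteSpace E] {g : E → E} {c : ℝ≥0} (hg : LipschitzWith c g) (hc : c < 1) :
    Function.Bijective fun x => x + g x := by
  have happ : ApproximatesLinearOn (fun x => x + g x)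
      (ContinuousLinearEquiv.refl ℝ E : E →L[ℝ] E) univ c := by
    rw [ApproximatesLinearOn.approximatesLinearOn_iff_lipschitzOnWith]
    have hsub : (fun x => x + g x) - ⇑(ContinuousLinearEquiv.refl ℝ E : E →L[ℝ] E) = g := by
      ext x
      simp
    rw [hsub]
    exact hg.lipschitzOnWith
  have hc' : Subsingleton E ∨
      c < ‖((ContinuousLinearEquiv.refl ℝ E).symm : E →L[ℝ] E)‖₊⁻¹ := by
    rcases subsingleton_or_nontrivial E with h | h
    · exact Or.inl h
    · right
      simpa using hc
  exact ⟨injOn_univ.1 (happ.injOn hc'), happ.surjective hc'⟩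

/-- For a Lipschitz vector field whose differential is almost everywhere trace-free, an explicit
Euler step of small size `h` distorts volumes by at most `exp (ε * h)`. -/
theorem exists_volume_preimage_eulerStep_le (d : ℕ) (L : ℝ≥0) {ε : ℝ} (hε : 0 < ε) :
    ∃ h₀ > 0, ∀ h : ℝ, 0 ≤ h → h ≤ h₀ → ∀ W : Euc d → Euc d, LipschitzWith L W →
      (∀ᵐ x, LinearMap.trace ℝ (Euc d) (fderiv ℝ W x : Euc d →ₗ[ℝ] Euc d) = 0) →
      ∀ A : Set (Euc d), MeasurableSet A →
        volume ((fun x => x + h • W x) ⁻¹' A) ≤ ENNReal.ofReal (Real.exp (ε * h)) * volume A ∧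
        volume A ≤ ENNReal.ofReal (Real.exp (ε * h)) *
          volume ((fun x => x + h • W x) ⁻¹' A) := by
  obtain ⟨h₁, h₁pos, hdet⟩ :=
    exists_abs_det_one_add_smul_sub_one_le (E := Euc d) L (half_pos hε)
  refine ⟨min h₁ (min (1 / ε) (1 / (L + 1) / 2)), by positivity,
    fun h h0 hh W hW htr A hA => ?_⟩
  have hh1 : h ≤ h₁ := hh.trans (min_le_left _ _)
  have hh2 : ε * h ≤ 1 := by
    have := hh.trans ((min_le_right _ _).trans (min_le_left _ _))
    rw [le_div_iff₀ hε] at this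
    linarith
  have hh3 : h * L < 1 := by
    have := hh.trans ((min_le_right _ _).trans (min_le_right _ _))
    rw [div_div, le_div_iff₀ (by positivity)] at this
    nlinarith [L.coe_nonneg]
  lift h to ℝ≥0 using h0
  have hg : LipschitzWith (h * L) fun x => (h : ℝ) • W x := by
    simpa using! (lipschitzWith_smul (h : ℝ)).comp hW
  refine volume_preimage_le_and_le_of_abs_det (LipschitzWith.id.add hg)
    (bijective_id_add_of_lipschitzWith hg (by exact_mod_cast hh3)) (Real.exp_pos _) ?_ hA
  filter_upwards [htr, hW.ae_differentiableAt] with x hx hdx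
  have hfd : fderiv ℝ (fun x => x + (h : ℝ) • W x) x = 1 + (h : ℝ) • fderiv ℝ W x :=
    ((hasFDerivAt_id x).add (hdx.hasFDerivAt.const_smul (h : ℝ))).fderiv
  have hb := abs_le.1
    (hdet h h.coe_nonneg hh1 (fderiv ℝ W x) (norm_fderiv_le_of_lipschitz ℝ hW) hx)
  have hεh : 0 ≤ ε * h := by positivity
  simp only [id] at hfd ⊢
  rw [hfd, abs_of_nonneg (by linarith)]
  have hexp := Real.add_one_le_exp (ε * h)
  refine ⟨by linarith, ?_⟩
  rw [inv_le_iff_one_le_mul₀ (Real.exp_pos _)]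
  calc (1 : ℝ) ≤ (1 - ε / 2 * h) * (ε * h + 1) := by nlinarith
    _ ≤ _ := mul_le_mul (by linarith) hexp (by linarith) (by linarith)

/-- A continuous map which is uniformly approximated by maps that distort volumes
arbitrarily little is volume preserving. -/
theorem measurePreserving_of_forall_exists_dist_le {d : ℕ} {Φ : Euc d → Euc d}
    (hΦ : Continuous Φ)
    (happ : ∀ δ > 0, ∃ T : Euc d → Euc d, (∀ x, dist (T x) (Φ x) ≤ δ) ∧
      ∀ A : Set (Euc d), MeasurableSet A →
        volume (T ⁻¹' A) ≤ ENNReal.ofReal (Real.exp δ) * volume A ∧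
        volume A ≤ ENNReal.ofReal (Real.exp δ) * volume (T ⁻¹' A)) :
    MeasurePreserving Φ := by
  have hupper : ∀ K : Set (Euc d), IsCompact K → ∀ δ > 0,
      volume (Φ ⁻¹' K) ≤ ENNReal.ofReal (Real.exp δ) * volume (Metric.cthickening δ K) := by
    intro K _ δ hδ
    obtain ⟨T, hT, hvol⟩ := happ δ hδ
    refine (measure_mono fun x hx => ?_).trans
      (hvol _ (Metric.isClosed_cthickening (δ := δ) (E := K)).measurableSet).1
    exact Metric.mem_cthickening_of_dist_le _ (Φ x) δ K hx (hT x)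
  have hlower : ∀ K : Set (Euc d), IsCompact K → ∀ δ > 0,
      volume K ≤ ENNReal.ofReal (Real.exp δ) * volume (Φ ⁻¹' Metric.cthickening δ K) := by
    intro K hK δ hδ
    obtain ⟨T, hT, hvol⟩ := happ δ hδ
    refine (hvol K hK.measurableSet).2.trans ?_
    gcongr
    intro x hx
    exact Metric.mem_cthickening_of_dist_le _ (T x) δ K hx (dist_comm (T x) (Φ x) ▸ hT x)
  have hmap : ∀ K : Set (Euc d), IsCompact K → map Φ volume K = volume (Φ ⁻¹' K) := fun K hK =>
    map_apply hΦ.measurable hK.measurableSet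
  have hfin : IsFiniteMeasureOnCompacts (map Φ (volume : Measure (Euc d))) := ⟨fun {K} hK => by
    rw [hmap K hK]
    exact (hupper K hK 1 one_pos).trans_lt
      (ENNReal.mul_lt_top ENNReal.ofReal_lt_top hK.cthickening.measure_lt_top)⟩
  have hlim : ∀ (μ : Measure (Euc d)) [IsFiniteMeasureOnCompacts μ] (K : Set (Euc d)),
      IsCompact K → Filter.Tendsto
        (fun δ : ℝ => ENNReal.ofReal (Real.exp δ) * μ (Metric.cthickening δ K)) (𝓝[>] 0)
        (𝓝 (μ K)) := by
    intro μ _ K hK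
    have h1 : Filter.Tendsto (fun δ : ℝ => ENNReal.ofReal (Real.exp δ)) (𝓝 0) (𝓝 1) := by
      have := (ENNReal.continuous_ofReal.comp Real.continuous_exp).tendsto 0
      simpa [Function.comp_def] using this
    have h2 := ENNReal.Tendsto.mul h1 (Or.inl one_ne_zero)
      (tendsto_measure_cthickening_of_isCompact (μ := μ) hK) (Or.inr ENNReal.one_ne_top)
    rw [one_mul] at h2
    exact h2.mono_left nhdsWithin_le_nhds
  have hcompact : ∀ K : Set (Euc d), IsCompact K → map Φ volume K = volume K := by
    intro K hK
    refine le_antisymm ?_ ?_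
    · refine ge_of_tendsto (hlim volume K hK) ?_
      filter_upwards [self_mem_nhdsWithin] with δ hδ
      rw [hmap K hK]
      exact hupper K hK δ hδ
    · refine ge_of_tendsto (hlim (map Φ volume) K hK) ?_
      filter_upwards [self_mem_nhdsWithin] with δ hδ
      rw [hmap _ hK.cthickening]
      exact hlower K hK δ hδ
  refine ⟨hΦ.measurable, OuterRegular.ext_isOpen fun U hU => ?_⟩
  rw [hU.measure_eq_iSup_isCompact, hU.measure_eq_iSup_isCompact]
  exact iSup_congr fun K => iSup_congr fun _ => iSup_congr fun hK => hcompact K hK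

/-- The explicit Euler scheme with step `h` for `∂ₜ Y = V(Y, t)`. -/
def eulerScheme {E : Type*} [NormedAddCommGroup E] [NormedSpace ℝ E] (V : E → ℝ → E) (h : ℝ) :
    ℕ → E → E
  | 0, x => x
  | k + 1, x => eulerScheme V h k x + h • V (eulerScheme V h k x) (k * h)

theorem continuous_eulerScheme {E : Type*} [NormedAddCommGroup E] [NormedSpace ℝ E]
    {V : E → ℝ → E} (hV : ∀ t, Continuous fun x => V x t) (h : ℝ) (k : ℕ) :
    Continuous (eulerScheme V h k) := by
  induction k with
  | zero => exact continuous_id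
  | succ k ih => exact ih.add (((hV _).comp ih).const_smul h)

/-- Local truncation error of the explicit Euler scheme. -/
theorem norm_sub_eulerStep_le {E : Type*} [NormedAddCommGroup E] [NormedSpace ℝ E]
    {V : E → ℝ → E} {C : ℝ} {L : ℝ≥0} (hVbdd : ∀ x t, ‖V x t‖ ≤ C)
    (hVlip : LipschitzWith L (fun p : E × ℝ => V p.1 p.2)) {y : ℝ → E}
    (hy : ∀ t : ℝ, 0 ≤ t → HasDerivWithinAt y (V (y t) t) (Ici 0) t)
    {s h : ℝ} (hs : 0 ≤ s) (hh : 0 ≤ h) :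
    ‖y (s + h) - (y s + h • V (y s) s)‖ ≤ L * (C + 1) * h ^ 2 := by
  have hC : 0 ≤ C := (norm_nonneg _).trans (hVbdd 0 0)
  have hsub : ∀ {a b : ℝ}, 0 ≤ a → Icc a b ⊆ Ici 0 := fun ha _ hx => ha.trans hx.1
  have hyLip : ∀ r ∈ Icc s (s + h), ‖y r - y s‖ ≤ C * (r - s) :=
    norm_image_sub_le_of_norm_deriv_le_segment'
      (fun r hr => (hy r (hs.trans hr.1)).mono (hsub hs)) fun r _ => hVbdd _ _
  have hderiv : ∀ r ∈ Icc s (s + h), HasDerivWithinAt (fun r => y r - (r - s) • V (y s) s)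
      (V (y r) r - V (y s) s) (Icc s (s + h)) r := by
    intro r hr
    have h1 := (hy r (hs.trans hr.1)).mono (hsub (b := s + h) hs)
    have h2 := (((hasDerivAt_id r).sub_const s).smul_const (V (y s) s)).hasDerivWithinAt
      (s := Icc s (s + h))
    simpa using! h1.sub h2
  have hbound : ∀ r ∈ Ico s (s + h), ‖V (y r) r - V (y s) s‖ ≤ L * ((C + 1) * h) := by
    intro r hr
    have h1 := hVlip.norm_sub_le (y r, r) (y s, s)
    refine h1.trans ?_
    gcongr
    have h2 := hyLip r ⟨hr.1, hr.2.le⟩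
    have h3 : r - s ≤ h := by linarith [hr.2]
    have h4 : 0 ≤ r - s := sub_nonneg.2 hr.1
    rw [Prod.norm_def]
    refine max_le ?_ ?_
    · simp only [Prod.fst_sub]
      nlinarith
    · simp only [Prod.snd_sub, Real.norm_eq_abs, abs_of_nonneg h4]
      nlinarith
  have := norm_image_sub_le_of_norm_deriv_le_segment' hderiv hbound (s + h)
    ⟨by linarith, le_rfl⟩
  simp only [add_sub_cancel_left, sub_self, zero_smul, sub_zero] at this
  calc _ = ‖y (s + h) - h • V (y s) s - y s‖ := by congr 1; abel
    _ ≤ _ := this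
    _ = _ := by ring

/-- Global error of the explicit Euler scheme. -/
theorem norm_eulerScheme_sub_le {E : Type*} [NormedAddCommGroup E] [NormedSpace ℝ E]
    {V : E → ℝ → E} {C : ℝ} {L : ℝ≥0} (hVbdd : ∀ x t, ‖V x t‖ ≤ C)
    (hVlip : LipschitzWith L (fun p : E × ℝ => V p.1 p.2)) {y : ℝ → E}
    (hy : ∀ t : ℝ, 0 ≤ t → HasDerivWithinAt y (V (y t) t) (Ici 0) t)
    {h : ℝ} (hh : 0 ≤ h) (k : ℕ) :
    ‖eulerScheme V h k (y 0) - y (k * h)‖ ≤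
      k * (L * (C + 1) * h ^ 2) * Real.exp (L * h * k) := by
  have hC : 0 ≤ C := (norm_nonneg _).trans (hVbdd 0 0)
  induction k with
  | zero => simp [eulerScheme]
  | succ k ih =>
    set z := eulerScheme V h k (y 0) with hz
    set s := (k : ℝ) * h with hs
    have hs0 : 0 ≤ s := by positivity
    set M := L * (C + 1) * h ^ 2 with hM
    have hM0 : 0 ≤ M := by positivity
    have hstep := norm_sub_eulerStep_le hVbdd hVlip hy hs0 hh
    have hsucc : ((k + 1 : ℕ) : ℝ) * h = s + h := by push_cast; ring
    have hV : ‖V z s - V (y s) s‖ ≤ L * ‖z - y s‖ := by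
      simpa [Prod.norm_def] using hVlip.norm_sub_le (z, s) (y s, s)
    have hexp1 : 1 ≤ Real.exp (L * h * (k + 1)) := Real.one_le_exp (by positivity)
    have hexp2 : (1 + L * h) * Real.exp (L * h * k) ≤ Real.exp (L * h * (k + 1)) := by
      rw [mul_add_one, Real.exp_add, mul_comm]
      gcongr
      linarith [Real.add_one_le_exp (L * h : ℝ)]
    rw [hsucc]
    calc ‖z + h • V z s - y (s + h)‖
        = ‖(z - y s) + h • (V z s - V (y s) s) - (y (s + h) - (y s + h • V (y s) s))‖ := by
          rw [smul_sub]; congr 1; abel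
      _ ≤ ‖z - y s‖ + h * (L * ‖z - y s‖) + M := by
          refine (norm_sub_le _ _).trans (add_le_add ((norm_add_le _ _).trans ?_) hstep)
          rw [norm_smul, Real.norm_of_nonneg hh]
          gcongr
      _ = (1 + L * h) * ‖z - y s‖ + M := by ring
      _ ≤ (1 + L * h) * (k * M * Real.exp (L * h * k)) + M := by gcongr
      _ = k * M * ((1 + L * h) * Real.exp (L * h * k)) + M * 1 := by ring
      _ ≤ k * M * Real.exp (L * h * (k + 1)) + M * Real.exp (L * h * (k + 1)) := by gcongr
      _ = _ := by push_cast; ring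

/-- Volume distortion of `k` steps of the Euler scheme, given that of each step. -/
theorem volume_preimage_eulerScheme_le {d : ℕ} {V : Euc d → ℝ → Euc d}
    (hV : ∀ t, Continuous fun x => V x t) {h ε : ℝ} (hh : 0 ≤ h)
    (hstep : ∀ s : ℝ, 0 ≤ s → ∀ A : Set (Euc d), MeasurableSet A →
        volume ((fun x => x + h • V x s) ⁻¹' A) ≤ ENNReal.ofReal (Real.exp ε) * volume A ∧
        volume A ≤ ENNReal.ofReal (Real.exp ε) * volume ((fun x => x + h • V x s) ⁻¹' A))
    (k : ℕ) {A : Set (Euc d)} (hA : MeasurableSet A) :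
    volume (eulerScheme V h k ⁻¹' A) ≤ ENNReal.ofReal (Real.exp (k * ε)) * volume A ∧
      volume A ≤ ENNReal.ofReal (Real.exp (k * ε)) * volume (eulerScheme V h k ⁻¹' A) := by
  induction k generalizing A with
  | zero =>
    have : eulerScheme V h 0 ⁻¹' A = A := rfl
    simp [this]
  | succ k ih =>
    set T : Euc d → Euc d := fun x => x + h • V x (k * h) with hT
    have hTm : MeasurableSet (T ⁻¹' A) :=
      (continuous_id.add ((hV _).const_smul h)).measurable hA
    have hpre : eulerScheme V h (k + 1) ⁻¹' A = eulerScheme V h k ⁻¹' (T ⁻¹' A) := rfl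
    have h1 := hstep (k * h) (by positivity) A hA
    have h2 := ih hTm
    have hexp : ENNReal.ofReal (Real.exp ((k + 1 : ℕ) * ε)) =
        ENNReal.ofReal (Real.exp ε) * ENNReal.ofReal (Real.exp (k * ε)) := by
      rw [← ENNReal.ofReal_mul (Real.exp_pos _).le, ← Real.exp_add]
      congr 2
      push_cast
      ring
    rw [hpre, hexp]
    constructor
    · calc _ ≤ _ := h2.1
        _ ≤ ENNReal.ofReal (Real.exp (k * ε)) * (ENNReal.ofReal (Real.exp ε) * volume A) := by
          gcongr
          exact h1.1
        _ = _ := by ring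
    · calc _ ≤ _ := h1.2
        _ ≤ ENNReal.ofReal (Real.exp ε) * (ENNReal.ofReal (Real.exp (k * ε)) * _) := by
          gcongr
          exact h2.2
        _ = _ := by ring

/-- **Liouville's theorem**: the flow of a bounded Lipschitz divergence-free vector field
preserves volume. -/
theorem measurePreserving_flow {d : ℕ} {V : Euc d → ℝ → Euc d} {C : ℝ} {L : ℝ≥0}
    (hVbdd : ∀ x t, ‖V x t‖ ≤ C)
    (hVlip : LipschitzWith L (fun p : Euc d × ℝ => V p.1 p.2)) (hVdiv : DivFree d V)
    {Y : Euc d → ℝ → Euc d} (hY0 : ∀ x, Y x 0 = x)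
    (hYderiv : ∀ x, ∀ t : ℝ, 0 ≤ t → HasDerivWithinAt (Y x) (V (Y x t) t) (Ici 0) t)
    {t : ℝ} (ht : 0 ≤ t) :
    Continuous (fun x => Y x t) ∧ MeasurePreserving (fun x => Y x t) := by
  have hlip : ∀ s, LipschitzWith L fun x => V x s := fun s =>
    LipschitzWith.of_dist_le_mul fun x y => by
      simpa [Prod.dist_eq] using hVlip.dist_le_mul (x, s) (y, s)
  have hcont : ∀ s, Continuous fun x => V x s := fun s => (hlip s).continuous
  have herr : ∀ n : ℕ, 0 < n → ∀ x, dist (eulerScheme V (t / n) n x) (Y x t) ≤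
      t ^ 2 * L * (C + 1) * Real.exp (L * t) / n := by
    intro n hn x
    have hn' : (n : ℝ) ≠ 0 := by positivity
    have := norm_eulerScheme_sub_le hVbdd hVlip (hYderiv x) (h := t / n) (by positivity) n
    rw [hY0, mul_div_cancel₀ _ hn', ← dist_eq_norm] at this
    refine this.trans_eq ?_
    rw [show (L : ℝ) * (t / n) * n = L * t by field_simp]
    field_simp
  have hlim : ∀ c : ℝ, Filter.Tendsto (fun n : ℕ => c / n) Filter.atTop (𝓝 0) := fun c =>
    tendsto_const_div_atTop_nhds_zero_nat c
  have hYcont : Continuous fun x => Y x t := by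
    have hunif : TendstoUniformly (fun (n : ℕ) x => eulerScheme V (t / n) n x)
        (fun x => Y x t) Filter.atTop := by
      rw [Metric.tendstoUniformly_iff]
      intro ε hε
      filter_upwards [(hlim _).eventually_lt_const hε, Filter.eventually_gt_atTop 0]
        with n hn hn0 x
      rw [dist_comm]
      exact (herr n hn0 x).trans_lt hn
    exact hunif.continuous (Filter.Frequently.of_forall fun n => continuous_eulerScheme hcont _ n)
  refine ⟨hYcont, measurePreserving_of_forall_exists_dist_le hYcont fun δ hδ => ?_⟩
  obtain ⟨h₀, h₀pos, hstep⟩ :=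
    exists_volume_preimage_eulerStep_le d L (ε := δ / (t + 1)) (by positivity)
  obtain ⟨n, hn1, hn2, hn0⟩ := ((hlim _).eventually_lt_const hδ |>.and
    (((hlim t).eventually_lt_const h₀pos).and (Filter.eventually_gt_atTop 0))).exists
  refine ⟨eulerScheme V (t / n) n, fun x => (herr n hn0 x).trans hn1.le, fun A hA => ?_⟩
  have hvol := volume_preimage_eulerScheme_le hcont (by positivity)
    (fun s hs => hstep (t / n) (by positivity) hn2.le _ (hlip s)
      (ae_trace_fderiv_eq_zero (hlip s) (hVdiv s hs))) n hA
  have hle : n * (δ / (t + 1) * (t / n)) ≤ δ := by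
    have : (n : ℝ) * (δ / (t + 1) * (t / n)) = δ * (t / (t + 1)) := by field_simp
    rw [this]
    exact mul_le_of_le_one_right hδ.le (div_le_one_of_le₀ (by linarith) (by positivity))
  exact ⟨hvol.1.trans (by gcongr), hvol.2.trans (by gcongr)⟩

/-- **Conservation of nonlinear functionals**: if `f : ℝ → ℝ` is measurable and
`f ∘ u0 ∈ L¹(ℝ^d)`, then for the exact solution `u(x,t) = u0(X(x,t))` the quantity
`∫ f(u(x,t)) dx` is independent of `t ≥ 0` and equals `∫ f(u0(x)) dx`. -/
theorem conservation_of_composition (d : ℕ) (hd : 1 ≤ d)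
    (V : Euc d → ℝ → Euc d) (CV : ℝ) (LV : ℝ≥0)
    (hVbdd : ∀ x t, ‖V x t‖ ≤ CV)
    (hVlip : LipschitzWith LV (fun p : Euc d × ℝ => V p.1 p.2))
    (hVdiv : DivFree d V)
    (Y X : Euc d → ℝ → Euc d)
    (hY0 : ∀ x, Y x 0 = x)
    (hYderiv : ∀ x, ∀ t : ℝ, 0 ≤ t → HasDerivWithinAt (Y x) (V (Y x t) t) (Ici 0) t)
    (hXY : ∀ t : ℝ, 0 ≤ t → ∀ x, X (Y x t) t = x)
    (hYX : ∀ t : ℝ, 0 ≤ t → ∀ x, Y (X x t) t = x)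
    (f : ℝ → ℝ) (hf : Measurable f)
    (u0 : Euc d → ℝ) (hu0 : LocallyIntegrable u0)
    (hfu0 : Integrable (fun x : Euc d => f (u0 x))) :
    ∀ t : ℝ, 0 ≤ t →
      ∫ x : Euc d, f (u0 (X x t)) = ∫ x : Euc d, f (u0 x) := by
  intro t ht
  obtain ⟨hcont, hmp⟩ := measurePreserving_flow hVbdd hVlip hVdiv hY0 hYderiv ht
  have hinj : Function.Injective fun x => Y x t :=
    Function.LeftInverse.injective (g := fun x => X x t) (hXY t ht)
  rw [← hmp.integral_comp (hcont.measurableEmbedding hinj) fun x => f (u0 (X x t))]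
  simp_rw [hXY t ht]
end
end
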